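/- arXiv:math/0512092 — 11 statements merged into one kernel-verified Lean document; each statement's English description precedes it below -/
import Mathlib

section
/- (Existence of Siegel zeros for functions of mold type, Lemma 3(i).) Assume b > d. Then for every ε > 0 there exists Y > 1 such that for every y > Y there exists a real number σ with −ε·(log y)⁻¹ < σ < ε·(log y)⁻¹, σ ≠ 0, and F(y,σ) = 0. -/
open Real Filter Set

theorem aux_unif (f : ℝ → ℝ → ℝ) (δ : ℝ) (hδ : 0 < δ)
    (h : TendstoUniformlyOn f (fun _ => 0) atTop (Set.Ioo (-δ) δ)) (u : ℝ → ℝ)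
    (hu : Tendsto u atTop (nhds 0)) : Tendsto (fun y => f y (u y)) atTop (nhds 0) := by
  rw [Metric.tendsto_nhds]
  intro e he
  rw [Metric.tendstoUniformlyOn_iff] at h
  have h1 := hu.eventually (Ioo_mem_nhds (neg_lt_zero.mpr hδ) hδ)
  filter_upwards [h e he, h1] with y hy hy1
  rw [dist_comm]
  exact hy _ hy1

/-- Existence of Siegel zeros for functions of mold type (Lemma 3(i)). -/
theorem siegel_zero_existence
    (a b c d : ℝ) (hbd : b > d)
    (A C : ℝ → ℝ)
    (δA : ℝ) (hδA : 0 < δA)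
    (hAcont : ContinuousOn A (Set.Ioo (-δA) δA))
    (hAne : ∀ σ ∈ Set.Ioo (-δA) δA, A σ ≠ 0)
    (hCcont : ContinuousOn C (Set.Ioo (-δA) δA))
    (hCne : ∀ σ ∈ Set.Ioo (-δA) δA, C σ ≠ 0)
    (B D : ℝ → ℝ → ℝ)
    (hBcont : ∀ y > (0:ℝ), Continuous (fun σ => B y σ))
    (hDcont : ∀ y > (0:ℝ), Continuous (fun σ => D y σ))
    (δu : ℝ) (hδu : 0 < δu)
    (hBlim : TendstoUniformlyOn (fun y σ => B y σ * y ^ (-(a * σ + b)))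
      (fun _ => 0) atTop (Set.Ioo (-δu) δu))
    (hDlim : TendstoUniformlyOn (fun y σ => D y σ * y ^ (-(c * σ + d)))
      (fun _ => 0) atTop (Set.Ioo (-δu) δu))
    (F : ℝ → ℝ → ℝ)
    (hF : ∀ y > (1:ℝ), ∀ σ : ℝ, σ ≠ 0 →
      F y σ = A σ * y ^ (a * σ + b) + B y σ
        + (1 / σ) * (C σ * y ^ (c * σ + d) + D y σ)) :
    ∀ ε > (0:ℝ), ∃ Y > (1:ℝ), ∀ y > Y, ∃ σ : ℝ,
      -ε * (Real.log y)⁻¹ < σ ∧ σ < ε * (Real.log y)⁻¹ ∧ σ ≠ 0 ∧ F y σ = 0 := by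
  intro ε hε
  have m0 : (0:ℝ) ∈ Set.Ioo (-δA) δA := ⟨by linarith, hδA⟩
  have hA0 := hAne 0 m0
  have hC0 := hCne 0 m0
  obtain ⟨s, hs, hsAC⟩ : ∃ s : ℝ, |s| = 1 ∧ C 0 * s * A 0 < 0 := by
    rcases lt_or_gt_of_ne (mul_ne_zero hC0 hA0) with h | h
    · exact ⟨1, by simp, by linarith⟩
    · exact ⟨-1, by simp, by linarith⟩
  set e := ε / 2 with he
  have he0 : 0 < e := by positivity
  set u : ℝ → ℝ := fun y => s * e * (Real.log y)⁻¹ with hu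
  have hu0 : Tendsto u atTop (nhds 0) := by
    have := (tendsto_inv_atTop_zero.comp Real.tendsto_log_atTop).const_mul (s * e)
    simpa [hu, Function.comp_def] using this
  have hAt : Tendsto (fun y => A (u y)) atTop (nhds (A 0)) :=
    ((hAcont.continuousAt (Ioo_mem_nhds m0.1 m0.2)).tendsto).comp hu0
  have hCt : Tendsto (fun y => C (u y)) atTop (nhds (C 0)) :=
    ((hCcont.continuousAt (Ioo_mem_nhds m0.1 m0.2)).tendsto).comp hu0
  have hBt := aux_unif _ δu hδu hBlim u hu0
  have hDt := aux_unif _ δu hδu hDlim u hu0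
  have hD0 := aux_unif _ δu hδu hDlim (fun _ => 0) tendsto_const_nhds
  have hgrow : Tendsto (fun y : ℝ => y ^ (b - d) / Real.log y) atTop atTop := by
    have h1 := (isLittleO_log_rpow_atTop (sub_pos.mpr hbd)).tendsto_div_nhds_zero
    have h2 : Tendsto (fun y : ℝ => Real.log y / y ^ (b - d)) atTop (nhdsWithin 0 (Set.Ioi 0)) := by
      refine tendsto_nhdsWithin_iff.mpr ⟨h1, ?_⟩
      filter_upwards [eventually_gt_atTop 1] with y hy
      have := Real.log_pos hy
      have : 0 < y ^ (b - d) := Real.rpow_pos_of_pos (by linarith) _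
      simp only [Set.mem_Ioi]
      positivity
    have h3 := h2.inv_tendsto_nhdsGT_zero
    refine h3.congr (fun y => ?_)
    simp
  set k := e * Real.exp ((a - c) * (s * e)) with hk
  have hk0 : 0 < k := by positivity
  have hneg : Tendsto (fun y => (y ^ (b - d) / Real.log y) *
      (k * (C 0 * s * (A (u y) + B y (u y) * y ^ (-(a * u y + b)))))
      + C 0 * (C (u y) + D y (u y) * y ^ (-(c * u y + d)))) atTop atBot := by
    have h1 : Tendsto (fun y => k * (C 0 * s * (A (u y) + B y (u y) * y ^ (-(a * u y + b)))))
        atTop (nhds (k * (C 0 * s * (A 0 + 0)))) :=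
      ((hAt.add hBt).const_mul _).const_mul _
    have h2 := (hCt.add hDt).const_mul (C 0)
    refine Tendsto.atBot_add (hgrow.atTop_mul_neg ?_ h1) h2
    rw [add_zero]
    exact mul_neg_of_pos_of_neg hk0 hsAC
  have hpos : ∀ᶠ y in atTop, 0 < C 0 * (C 0 + D y 0 * y ^ (-(c * 0 + d))) := by
    have h2 := (hD0.const_add (C 0)).const_mul (C 0)
    refine h2.eventually (lt_mem_nhds ?_)
    rw [add_zero]
    exact mul_self_pos.mpr hC0
  have hsmall : ∀ᶠ y in atTop, |u y| < δA := by
    have := hu0.abs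
    rw [abs_zero] at this
    exact this.eventually (gt_mem_nhds hδA)
  obtain ⟨Y, hY⟩ := eventually_atTop.mp ((hneg.eventually_lt_atBot 0).and (hpos.and hsmall))
  refine ⟨max Y 2, lt_max_of_lt_right (by norm_num), fun y hy => ?_⟩
  obtain ⟨hn, hp, hsm⟩ := hY y ((le_max_left _ _).trans hy.le)
  have hy1 : 1 < y := by
    have := (le_max_right Y 2).trans_lt hy
    linarith
  have hy0 : 0 < y := by linarith
  have hL := Real.log_pos hy1
  set G : ℝ → ℝ := fun σ => C 0 * (σ * (A σ * y ^ (a * σ + b) + B y σ)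
    + (C σ * y ^ (c * σ + d) + D y σ)) with hG
  have hP : ∀ x : ℝ, y ^ x * y ^ (-x) = 1 := fun x => by
    rw [← Real.rpow_add hy0]; simp
  have hG0 : 0 < G 0 := by
    have h := mul_pos (Real.rpow_pos_of_pos hy0 (c * 0 + d)) hp
    have h2 := hP (c * 0 + d)
    have : G 0 = y ^ (c * 0 + d) * (C 0 * (C 0 + D y 0 * y ^ (-(c * 0 + d)))) := by
      simp only [hG]
      linear_combination (-(C 0 * D y 0)) * h2
    rwa [this]
  have hG1 : G (u y) < 0 := by
    have h := mul_neg_of_pos_of_neg (Real.rpow_pos_of_pos hy0 (c * u y + d)) hn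
    have h2 := hP (c * u y + d)
    have h3 := hP (a * u y + b)
    have hul : u y * Real.log y = s * e := by
      simp only [hu]; field_simp
    have h4 : y ^ (c * u y + d) * (y ^ (b - d) * Real.exp ((a - c) * (s * e)))
        = y ^ (a * u y + b) := by
      rw [Real.rpow_def_of_pos hy0, Real.rpow_def_of_pos hy0, Real.rpow_def_of_pos hy0,
        ← Real.exp_add, ← Real.exp_add, ← hul]
      congr 1
      ring
    have h5 : y ^ (b - d) / Real.log y * (k * (C 0 * s * (A (u y) + B y (u y) * y ^ (-(a * u y + b)))))
        = C 0 * u y * (y ^ (b - d) * Real.exp ((a - c) * (s * e)))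
          * (A (u y) + B y (u y) * y ^ (-(a * u y + b))) := by
      have : u y = s * e * (Real.log y)⁻¹ := rfl
      generalize A (u y) + B y (u y) * y ^ (-(a * u y + b)) = w
      rw [this, hk]
      ring
    rw [h5] at h
    refine lt_of_eq_of_lt ?_ h
    simp only [hG]
    linear_combination (-(C 0 * D y (u y))) * h2 - C 0 * u y * B y (u y) * h3
      - C 0 * u y * (A (u y) + B y (u y) * y ^ (-(a * u y + b))) * h4
  have hsub : Set.uIcc 0 (u y) ⊆ Set.Ioo (-δA) δA := by
    intro x hx
    have := Set.abs_sub_left_of_mem_uIcc hx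
    rw [sub_zero, sub_zero] at this
    exact abs_lt.mp (this.trans_lt hsm)
  have hcont : ContinuousOn G (Set.uIcc 0 (u y)) := by
    have c1 := hAcont.mono hsub
    have c2 := hCcont.mono hsub
    have c3 := (hBcont y hy0).continuousOn (s := Set.uIcc 0 (u y))
    have c4 := (hDcont y hy0).continuousOn (s := Set.uIcc 0 (u y))
    have c5 : ∀ p q : ℝ, ContinuousOn (fun σ : ℝ => y ^ (p * σ + q)) (Set.uIcc 0 (u y)) := by
      intro p q
      refine Continuous.continuousOn ?_
      exact Continuous.rpow continuous_const (by fun_prop) (fun _ => Or.inl hy0.ne')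
    exact continuousOn_const.mul ((continuousOn_id.mul ((c1.mul (c5 a b)).add c3)).add
      ((c2.mul (c5 c d)).add c4))
  obtain ⟨x, hx, hx0⟩ := intermediate_value_uIcc hcont
    (Set.mem_uIcc.mpr (Or.inr ⟨hG1.le, hG0.le⟩))
  have hxne : x ≠ 0 := by
    rintro rfl
    exact hG0.ne' hx0
  have hxabs : |x| < ε * (Real.log y)⁻¹ := by
    have h1 := Set.abs_sub_left_of_mem_uIcc hx
    rw [sub_zero, sub_zero] at h1
    have h2 : |u y| = e * (Real.log y)⁻¹ := by
      simp only [hu]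
      rw [abs_mul, abs_mul, hs, abs_of_pos he0, abs_of_pos (inv_pos.mpr hL), one_mul]
    rw [h2] at h1
    refine h1.trans_lt (mul_lt_mul_of_pos_right (by linarith) (inv_pos.mpr hL))
  obtain ⟨l1, l2⟩ := abs_lt.mp hxabs
  refine ⟨x, by linarith, l2, hxne, ?_⟩
  rw [hF y hy1 x hxne]
  have h6 := (mul_eq_zero.mp hx0).resolve_left hC0
  have h7 : x * (1 / x) = 1 := mul_one_div_cancel hxne
  linear_combination (1 / x) * h6 - (A x * y ^ (a * x + b) + B y x) * h7
end

section
/- (Asymptotic formula for the Siegel zero, Lemma 3(ii).) Assume b > d. Fix ε > 0 and let Y > 1 be such that for every y > Y the function F(y,·) vanishes at some point of (−ε·(log y)⁻¹, ε·(log y)⁻¹) \ {0}. Let β : (Y,∞) → ℝ be any function such that for each y > Y one has β(y) ∈ (−ε·(log y)⁻¹, ε·(log y)⁻¹), β(y) ≠ 0, and F(y, β(y)) = 0. Then −β(y) ∼ C(0)/(A(0)·y^{b−d}) as y → ∞; that is, the limit as y → ∞ of (−β(y))·A(0)·y^{b−d}/C(0) equals 1. -/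
open Real Filter Set

/-- Asymptotic formula for the Siegel zero (Lemma 3(ii)). -/
theorem siegel_zero_asymptotic
    (a b c d : ℝ) (hbd : b > d)
    (A C : ℝ → ℝ)
    (δA : ℝ) (hδA : 0 < δA)
    (hAcont : ContinuousOn A (Set.Ioo (-δA) δA))
    (hAne : ∀ σ ∈ Set.Ioo (-δA) δA, A σ ≠ 0)
    (hCcont : ContinuousOn C (Set.Ioo (-δA) δA))
    (hCne : ∀ σ ∈ Set.Ioo (-δA) δA, C σ ≠ 0)
    (B D : ℝ → ℝ → ℝ)
    (hBcont : ∀ y > (0:ℝ), Continuous (fun σ => B y σ))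
    (hDcont : ∀ y > (0:ℝ), Continuous (fun σ => D y σ))
    (δu : ℝ) (hδu : 0 < δu)
    (hBlim : TendstoUniformlyOn (fun y σ => B y σ * y ^ (-(a * σ + b)))
      (fun _ => 0) atTop (Set.Ioo (-δu) δu))
    (hDlim : TendstoUniformlyOn (fun y σ => D y σ * y ^ (-(c * σ + d)))
      (fun _ => 0) atTop (Set.Ioo (-δu) δu))
    (F : ℝ → ℝ → ℝ)
    (hF : ∀ y > (1:ℝ), ∀ σ : ℝ, σ ≠ 0 →
      F y σ = A σ * y ^ (a * σ + b) + B y σ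
        + (1 / σ) * (C σ * y ^ (c * σ + d) + D y σ))
    (ε : ℝ) (hε : 0 < ε) (Y : ℝ) (hY : 1 < Y)
    (hzero : ∀ y > Y, ∃ σ : ℝ,
      -ε * (Real.log y)⁻¹ < σ ∧ σ < ε * (Real.log y)⁻¹ ∧ σ ≠ 0 ∧ F y σ = 0)
    (β : ℝ → ℝ)
    (hβ : ∀ y > Y, -ε * (Real.log y)⁻¹ < β y ∧ β y < ε * (Real.log y)⁻¹
      ∧ β y ≠ 0 ∧ F y (β y) = 0) :
    Tendsto (fun y => (-β y) * A 0 * y ^ (b - d) / C 0) atTop (nhds 1) := by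
  have h0A : (0:ℝ) ∈ Set.Ioo (-δA) δA := ⟨by linarith, hδA⟩
  have hA0 := hAne 0 h0A
  have hC0 := hCne 0 h0A
  have hlogtop : Tendsto (fun y : ℝ => ε * (Real.log y)⁻¹) atTop (nhds 0) := by
    simpa using (tendsto_inv_atTop_zero.comp Real.tendsto_log_atTop).const_mul ε
  have hβ0 : Tendsto β atTop (nhds 0) := by
    refine tendsto_of_tendsto_of_tendsto_of_le_of_le' (by simpa using hlogtop.neg) hlogtop ?_ ?_
    · filter_upwards [eventually_gt_atTop Y] with y hy
      have := (hβ y hy).1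
      linarith
    · filter_upwards [eventually_gt_atTop Y] with y hy
      exact (hβ y hy).2.1.le
  have hmem : ∀ᶠ y in atTop, β y ∈ Set.Ioo (-δu) δu :=
    hβ0.eventually (Ioo_mem_nhds (by linarith) hδu)
  have key : ∀ G : ℝ → ℝ → ℝ, TendstoUniformlyOn G (fun _ => 0) atTop (Set.Ioo (-δu) δu) →
      Tendsto (fun y => G y (β y)) atTop (nhds 0) := by
    intro G hG
    rw [Metric.tendstoUniformlyOn_iff] at hG
    rw [Metric.tendsto_nhds]
    intro e he
    filter_upwards [hG e he, hmem] with y h1 h2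
    rw [dist_comm]
    exact h1 _ h2
  have hnA : Set.Ioo (-δA) δA ∈ nhds (0:ℝ) := Ioo_mem_nhds h0A.1 h0A.2
  have hP : Tendsto (fun y => A (β y) + B y (β y) * y ^ (-(a * β y + b))) atTop (nhds (A 0)) := by
    simpa using ((hAcont.continuousAt hnA).tendsto.comp hβ0).add (key _ hBlim)
  have hQ : Tendsto (fun y => C (β y) + D y (β y) * y ^ (-(c * β y + d))) atTop (nhds (C 0)) := by
    simpa using ((hCcont.continuousAt hnA).tendsto.comp hβ0).add (key _ hDlim)
  set P := fun y => A (β y) + B y (β y) * y ^ (-(a * β y + b)) with hPdef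
  set Q := fun y => C (β y) + D y (β y) * y ^ (-(c * β y + d)) with hQdef
  have hQP : Tendsto (fun y => Q y / P y) atTop (nhds (C 0 / A 0)) := hQ.div hP hA0
  have hPne : ∀ᶠ y in atTop, P y ≠ 0 := hP.eventually_ne hA0
  have hg : ∀ᶠ y in atTop,
      (-β y) * y ^ (b - d) = Real.exp ((c - a) * (β y * Real.log y)) * (Q y / P y) := by
    filter_upwards [eventually_gt_atTop Y, hPne] with y hy hPy
    obtain ⟨-, -, hb0, hFz⟩ := hβ y hy
    have hy1 : 1 < y := hY.trans hy
    have hy0 : 0 < y := by linarith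
    rw [hF y hy1 _ hb0] at hFz
    have e1 : A (β y) * y ^ (a * β y + b) + B y (β y) = P y * y ^ (a * β y + b) := by
      simp only [hPdef, add_mul, mul_assoc]
      rw [← Real.rpow_add hy0]; simp
    have e2 : C (β y) * y ^ (c * β y + d) + D y (β y) = Q y * y ^ (c * β y + d) := by
      simp only [hQdef, add_mul, mul_assoc]
      rw [← Real.rpow_add hy0]; simp
    rw [e1, e2] at hFz
    have e3 : -β y * (P y * y ^ (a * β y + b)) = Q y * y ^ (c * β y + d) := by
      have h1 : β y * (1 / β y) = 1 := by field_simp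
      linear_combination (-β y) * hFz + Q y * y ^ (c * β y + d) * h1
    have e4 : Real.exp ((c - a) * (β y * Real.log y)) = y ^ ((c - a) * β y) := by
      rw [Real.rpow_def_of_pos hy0]; ring_nf
    rw [e4, ← mul_div_assoc, eq_div_iff hPy]
    have e5 : y ^ (b - d) = y ^ (a * β y + b) * y ^ (-(a * β y + d)) := by
      rw [← Real.rpow_add hy0]; ring_nf
    have e6 : y ^ ((c - a) * β y) = y ^ (c * β y + d) * y ^ (-(a * β y + d)) := by
      rw [← Real.rpow_add hy0]; ring_nf
    rw [e5, e6]
    linear_combination y ^ (-(a * β y + d)) * e3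
  have hlog : Tendsto (fun y : ℝ => Real.log y / y ^ (b - d)) atTop (nhds 0) :=
    (isLittleO_log_rpow_atTop (by linarith : 0 < b - d)).tendsto_div_nhds_zero
  have hbl : Tendsto (fun y => β y * Real.log y) atTop (nhds 0) := by
    have hbd1 : Tendsto (fun y => Real.exp (|c - a| * ε) * |Q y / P y| *
        |Real.log y / y ^ (b - d)|) atTop (nhds 0) := by
      simpa using (hQP.abs.const_mul (Real.exp (|c - a| * ε))).mul hlog.abs
    refine squeeze_zero_norm' ?_ hbd1
    filter_upwards [eventually_gt_atTop Y, hg] with y hy hgy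
    obtain ⟨h1, h2, -, -⟩ := hβ y hy
    have hy1 : 1 < y := hY.trans hy
    have hy0 : 0 < y := by linarith
    have hl : 0 < Real.log y := Real.log_pos hy1
    have hyp : 0 < y ^ (b - d) := Real.rpow_pos_of_pos hy0 _
    have hle : |β y * Real.log y| ≤ ε := by
      rw [abs_mul, abs_of_pos hl, ← le_div_iff₀ hl, div_eq_mul_inv]
      exact abs_le.2 ⟨by linarith, h2.le⟩
    have e : β y * Real.log y =
        -(Real.exp ((c - a) * (β y * Real.log y)) * (Q y / P y) * (Real.log y / y ^ (b - d))) := by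
      rw [← hgy]; field_simp
    rw [Real.norm_eq_abs]
    have hE : Real.exp ((c - a) * (β y * Real.log y)) ≤ Real.exp (|c - a| * ε) := by
      apply Real.exp_le_exp.2
      refine (le_abs_self _).trans ?_
      rw [abs_mul]
      gcongr
    calc |β y * Real.log y| = Real.exp ((c - a) * (β y * Real.log y)) * |Q y / P y| *
          |Real.log y / y ^ (b - d)| := by
          conv_lhs => rw [e]
          rw [abs_neg, abs_mul, abs_mul, Real.abs_exp]
      _ ≤ _ := by gcongr
  have hexp : Tendsto (fun y => Real.exp ((c - a) * (β y * Real.log y))) atTop (nhds 1) := by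
    have := (Real.continuous_exp.tendsto _).comp (hbl.const_mul (c - a))
    simpa [Function.comp_def] using this
  have hfin := ((hexp.mul hQP).mul_const (A 0)).div_const (C 0)
  have hone : 1 * (C 0 / A 0) * A 0 / C 0 = 1 := by field_simp
  rw [hone] at hfin
  refine hfin.congr' ?_
  filter_upwards [hg] with y hy
  rw [← hy]; ring
end

section
/- (Nonvanishing when the exponents are reversed, Remark 1 after Lemma 3.) Assume b < d. Then there exist δ > 0 and Y > 1 such that for every y > Y and every σ with 0 < |σ| < δ one has F(y,σ) ≠ 0. -/
open Real Filter Set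

/-- Nonvanishing when the exponents are reversed (Remark 1 after Lemma 3). -/
theorem no_siegel_zero_reversed_exponents
    (a b c d : ℝ) (hbd : b < d)
    (A C : ℝ → ℝ)
    (δA : ℝ) (hδA : 0 < δA)
    (hAcont : ContinuousOn A (Set.Ioo (-δA) δA))
    (hAne : ∀ σ ∈ Set.Ioo (-δA) δA, A σ ≠ 0)
    (hCcont : ContinuousOn C (Set.Ioo (-δA) δA))
    (hCne : ∀ σ ∈ Set.Ioo (-δA) δA, C σ ≠ 0)
    (B D : ℝ → ℝ → ℝ)
    (hBcont : ∀ y > (0:ℝ), Continuous (fun σ => B y σ))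
    (hDcont : ∀ y > (0:ℝ), Continuous (fun σ => D y σ))
    (δu : ℝ) (hδu : 0 < δu)
    (hBlim : TendstoUniformlyOn (fun y σ => B y σ * y ^ (-(a * σ + b)))
      (fun _ => 0) atTop (Set.Ioo (-δu) δu))
    (hDlim : TendstoUniformlyOn (fun y σ => D y σ * y ^ (-(c * σ + d)))
      (fun _ => 0) atTop (Set.Ioo (-δu) δu))
    (F : ℝ → ℝ → ℝ)
    (hF : ∀ y > (1:ℝ), ∀ σ : ℝ, σ ≠ 0 →
      F y σ = A σ * y ^ (a * σ + b) + B y σ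
        + (1 / σ) * (C σ * y ^ (c * σ + d) + D y σ)) :
    ∃ δ > (0:ℝ), ∃ Y > (1:ℝ), ∀ y > Y, ∀ σ : ℝ, 0 < |σ| → |σ| < δ → F y σ ≠ 0 := by
  have h0 : (0:ℝ) ∈ Set.Ioo (-δA) δA := ⟨by linarith, hδA⟩
  have hk : 0 < |C 0| := abs_pos.mpr (hCne 0 h0)
  obtain ⟨k, hkdef⟩ : ∃ k, k = |C 0| := ⟨_, rfl⟩
  rw [← hkdef] at hk
  have hCc : ContinuousAt (fun σ => |C σ|) 0 :=
    (hCcont.continuousAt (Ioo_mem_nhds h0.1 h0.2)).abs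
  have hAc : ContinuousAt (fun σ => |A σ|) 0 :=
    (hAcont.continuousAt (Ioo_mem_nhds h0.1 h0.2)).abs
  obtain ⟨M, hM⟩ : ∃ M, M = |A 0| + 1 := ⟨_, rfl⟩
  have e1 : ∀ᶠ σ in nhds (0:ℝ), k / 2 < |C σ| :=
    hCc.eventually (lt_mem_nhds (by simp only [← hkdef]; linarith))
  have e2 : ∀ᶠ σ in nhds (0:ℝ), |A σ| < M :=
    hAc.eventually (gt_mem_nhds (by simp only [hM]; linarith))
  have e3 : ∀ᶠ σ in nhds (0:ℝ), a * σ + b < c * σ + d := by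
    have h1 : ContinuousAt (fun σ : ℝ => a * σ + b) 0 := by fun_prop
    have h2 : ContinuousAt (fun σ : ℝ => c * σ + d) 0 := by fun_prop
    exact h1.eventually_lt h2 (by simpa using hbd)
  have e4 : ∀ᶠ σ in nhds (0:ℝ), |σ| * (M + 1) < k / 4 := by
    have h1 : ContinuousAt (fun σ : ℝ => |σ| * (M + 1)) 0 := by fun_prop
    exact h1.eventually (gt_mem_nhds (by simp only [abs_zero, zero_mul]; linarith))
  have e5 : ∀ᶠ σ in nhds (0:ℝ), σ ∈ Set.Ioo (-δu) δu :=
    Ioo_mem_nhds (by linarith) hδu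
  obtain ⟨δ, hδ, H⟩ := Metric.eventually_nhds_iff.mp
    (e1.and (e2.and (e3.and (e4.and e5))))
  rw [Metric.tendstoUniformlyOn_iff] at hBlim hDlim
  obtain ⟨Y, hY⟩ := eventually_atTop.mp
    ((hBlim 1 one_pos).and (hDlim (k / 4) (by linarith)))
  refine ⟨δ, hδ, max Y 2, lt_of_lt_of_le (by norm_num) (le_max_right _ _), ?_⟩
  intro y hy σ hσ0 hσ hz
  have hy1 : Y ≤ y := (le_max_left _ _).trans hy.le
  have hy2 : 1 < y := by
    have := (le_max_right Y 2).trans hy.le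
    linarith
  obtain ⟨f1, f2, f3, f4, f5⟩ := H (y := σ) (by simpa [Real.dist_eq] using hσ)
  have gB := (hY y hy1).1 σ f5
  have gD := (hY y hy1).2 σ f5
  have hσne : σ ≠ 0 := abs_pos.mp hσ0
  rw [hF y hy2 σ hσne] at hz
  have hy0 : 0 < y := by linarith
  have hP := Real.rpow_pos_of_pos hy0 (c * σ + d)
  have hQ := Real.rpow_pos_of_pos hy0 (a * σ + b)
  have hQP := Real.rpow_le_rpow_of_exponent_le hy2.le f3.le
  rw [dist_zero_left, Real.norm_eq_abs, Real.rpow_neg hy0.le, abs_mul, abs_inv] at gB gD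
  generalize y ^ (c * σ + d) = P at *
  generalize y ^ (a * σ + b) = Q at *
  rw [abs_of_pos hQ, ← div_eq_mul_inv, div_lt_iff₀ hQ] at gB
  rw [abs_of_pos hP, ← div_eq_mul_inv, div_lt_iff₀ hP] at gD
  have key : C σ * P = -(D y σ + σ * (A σ * Q + B y σ)) := by
    field_simp at hz
    linarith
  have k1 : |C σ| * P ≤ |D y σ| + |σ| * (|A σ| * Q + |B y σ|) := by
    calc |C σ| * P = |C σ * P| := by rw [abs_mul, abs_of_pos hP]
      _ = |D y σ + σ * (A σ * Q + B y σ)| := by rw [key, abs_neg]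
      _ ≤ |D y σ| + |σ * (A σ * Q + B y σ)| := abs_add_le _ _
      _ = |D y σ| + |σ| * |A σ * Q + B y σ| := by rw [abs_mul]
      _ ≤ |D y σ| + |σ| * (|A σ * Q| + |B y σ|) := by gcongr; exact abs_add_le _ _
      _ = _ := by rw [abs_mul (A σ), abs_of_pos hQ]
  have k2 : |σ| * (|A σ| * Q + |B y σ|) ≤ |σ| * (M * Q + 1 * Q) := by gcongr
  have k3 : |σ| * (M * Q + 1 * Q) ≤ k / 4 * P := by
    calc |σ| * (M * Q + 1 * Q) = (|σ| * (M + 1)) * Q := by ring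
      _ ≤ k / 4 * Q := by gcongr
      _ ≤ k / 4 * P := by gcongr
  have k4 : k / 2 * P < |C σ| * P := by gcongr
  linarith
end

section
/- (Siegel zeros persist when C(0) = 0, Remark 2 after Lemma 3, made precise.) Assume c = d = 0, b > 0, and A(0) > 0, and assume there exist η > 0, δ₀ > 0 and Y₀ > 1 such that C(σ) + D(y,σ) ≥ η for all y > Y₀ and all σ with |σ| < δ₀. Then for every ε > 0 there exists Y > 1 such that for every y > Y there exists σ ∈ (−ε·(log y)⁻¹, 0) with F(y,σ) = 0. -/
open Real Filter Set

/-- Siegel zeros persist when C(0) = 0 (Remark 2 after Lemma 3, made precise). -/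
theorem siegel_zero_C_zero
    (a b : ℝ) (hb : 0 < b)
    (A C : ℝ → ℝ)
    (δA : ℝ) (hδA : 0 < δA)
    (hAcont : ContinuousOn A (Set.Ioo (-δA) δA))
    (hAne : ∀ σ ∈ Set.Ioo (-δA) δA, A σ ≠ 0)
    (hA0 : 0 < A 0)
    (hCcont : ContinuousOn C (Set.Ioo (-δA) δA))
    (hC0 : C 0 = 0)
    (B D : ℝ → ℝ → ℝ)
    (hBcont : ∀ y > (0:ℝ), Continuous (fun σ => B y σ))
    (hDcont : ∀ y > (0:ℝ), Continuous (fun σ => D y σ))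
    (δu : ℝ) (hδu : 0 < δu)
    (hBlim : TendstoUniformlyOn (fun y σ => B y σ * y ^ (-(a * σ + b)))
      (fun _ => 0) atTop (Set.Ioo (-δu) δu))
    (η δ₀ Y₀ : ℝ) (hη : 0 < η) (hδ₀ : 0 < δ₀) (hY₀ : 1 < Y₀)
    (hCD : ∀ y > Y₀, ∀ σ : ℝ, |σ| < δ₀ → η ≤ C σ + D y σ)
    (hDbd : ∃ K : ℝ, ∀ y > Y₀, ∀ σ : ℝ, |σ| < δ₀ → |D y σ| ≤ K)
    (F : ℝ → ℝ → ℝ)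
    (hF : ∀ y > (1:ℝ), ∀ σ : ℝ, σ ≠ 0 →
      F y σ = A σ * y ^ (a * σ + b) + B y σ + (1 / σ) * (C σ + D y σ)) :
    ∀ ε > (0:ℝ), ∃ Y > (1:ℝ), ∀ y > Y, ∃ σ : ℝ,
      -ε * (Real.log y)⁻¹ < σ ∧ σ < 0 ∧ F y σ = 0 := by
  intro ε hε
  obtain ⟨K, hK⟩ := hDbd
  have hmem : Set.Ioo (-δA) δA ∈ nhds (0:ℝ) := Ioo_mem_nhds (by linarith) hδA
  have hA1 : ∀ᶠ σ in nhds (0:ℝ), A 0 / 2 < A σ :=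
    (hAcont.continuousAt hmem).eventually (lt_mem_nhds (by linarith))
  have hC1 : ∀ᶠ σ in nhds (0:ℝ), C σ < 1 :=
    (hCcont.continuousAt hmem).eventually (gt_mem_nhds (by rw [hC0]; norm_num))
  have hd1 : ∀ᶠ σ in nhds (0:ℝ), σ ∈ Set.Ioo (-δ₀) δ₀ := Ioo_mem_nhds (by linarith) hδ₀
  have hu1 : ∀ᶠ σ in nhds (0:ℝ), σ ∈ Set.Ioo (-δu) δu := Ioo_mem_nhds (by linarith) hδu
  have hm1 : ∀ᶠ σ in nhds (0:ℝ), σ ∈ Set.Ioo (-δA) δA := hmem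
  have hs : Tendsto (fun y : ℝ => -(ε / 2) * (Real.log y)⁻¹) atTop (nhds 0) := by
    simpa using (tendsto_inv_atTop_zero.comp Real.tendsto_log_atTop).const_mul (-(ε / 2))
  have hev := hs.eventually (hA1.and (hC1.and (hd1.and (hu1.and hm1))))
  have hB1 := (Metric.tendstoUniformlyOn_iff.1 hBlim) (A 0 / 4) (by linarith)
  set κ : ℝ := (ε / 2) * Real.exp (-(a * (ε / 2))) * (A 0 / 4) with hκ
  have hκpos : 0 < κ := by positivity
  have hL := (isLittleO_log_rpow_atTop hb).def (c := κ / (|K| + 2)) (by positivity)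
  obtain ⟨N, hN⟩ := eventually_atTop.1 (hev.and (hB1.and hL))
  refine ⟨max N (max Y₀ 2), by simp, ?_⟩
  intro y hy
  have hyN : N < y := lt_of_le_of_lt (le_max_left _ _) hy
  have hyY : Y₀ < y := lt_of_le_of_lt ((le_max_left _ _).trans (le_max_right _ _)) hy
  have hy1 : 1 < y := by linarith
  have hy0 : 0 < y := by linarith
  have hlog : 0 < Real.log y := Real.log_pos hy1
  obtain ⟨⟨hAs, hCs, hds, hus, hms⟩, hBs, hLs⟩ := hN y hyN.le
  set s : ℝ := -(ε / 2) * (Real.log y)⁻¹ with hsdef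
  have hsl : s * Real.log y = -(ε / 2) := by rw [hsdef]; field_simp
  have hli : 0 < (Real.log y)⁻¹ := inv_pos.2 hlog
  have hsneg : s < 0 := by rw [hsdef]; nlinarith
  have hBs' := hBs s hus
  rw [Real.dist_eq] at hBs'
  have hBs2 := (abs_lt.1 hBs').2
  have hp : 0 < y ^ (a * s + b) := Real.rpow_pos_of_pos hy0 _
  have hpe : y ^ (a * s + b) = Real.exp (-(a * (ε / 2))) * y ^ b := by
    rw [Real.rpow_add hy0, Real.rpow_def_of_pos hy0 (a * s)]
    congr 2
    linear_combination a * hsl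
  have hBp : -(A 0 / 4) * y ^ (a * s + b) < B y s := by
    rw [Real.rpow_neg hy0.le] at hBs2
    have h1 : -(A 0 / 4) < B y s * (y ^ (a * s + b))⁻¹ := by linarith
    rwa [← div_eq_mul_inv, lt_div_iff₀ hp] at h1
  have hsum : A 0 / 4 * y ^ (a * s + b) < A s * y ^ (a * s + b) + B y s := by nlinarith
  have hyb : 0 < y ^ b := Real.rpow_pos_of_pos hy0 _
  rw [Real.norm_of_nonneg hlog.le, Real.norm_of_nonneg hyb.le] at hLs
  have hK2 : 0 < |K| + 2 := by positivity
  have hL2 : (|K| + 2) * Real.log y ≤ κ * y ^ b := by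
    rw [div_mul_eq_mul_div, le_div_iff₀ hK2] at hLs
    linarith
  have hDs : D y s ≤ |K| :=
    (le_abs_self _).trans ((hK y hyY s (abs_lt.2 hds)).trans (le_abs_self _))
  have hkey : |K| + 2 ≤ -s * (A 0 / 4 * y ^ (a * s + b)) := by
    have h2 : -s * (A 0 / 4 * y ^ (a * s + b)) = κ * y ^ b / Real.log y := by
      rw [hpe, hκ, hsdef]; field_simp
    rw [h2, le_div_iff₀ hlog]
    exact hL2
  let G : ℝ → ℝ := fun σ => σ * (A σ * y ^ (a * σ + b) + B y σ) + (C σ + D y σ)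
  have hG1 : G s < 0 := by
    have h3 : -s * (A 0 / 4 * y ^ (a * s + b)) < -s * (A s * y ^ (a * s + b) + B y s) :=
      mul_lt_mul_of_pos_left hsum (by linarith)
    show s * (A s * y ^ (a * s + b) + B y s) + (C s + D y s) < 0
    linarith
  have hG0 : 0 < G 0 := by
    have := hCD y hyY 0 (by simpa using hδ₀)
    show 0 < 0 * (A 0 * y ^ (a * 0 + b) + B y 0) + (C 0 + D y 0)
    linarith
  have hsub : Set.Icc s 0 ⊆ Set.Ioo (-δA) δA := fun x hx =>
    ⟨lt_of_lt_of_le hms.1 hx.1, lt_of_le_of_lt hx.2 hδA⟩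
  have hpc : Continuous (fun σ : ℝ => y ^ (a * σ + b)) :=
    (Real.continuous_const_rpow hy0.ne').comp (by fun_prop)
  have hGc : ContinuousOn G (Set.Icc s 0) :=
    (continuousOn_id.mul (((hAcont.mono hsub).mul hpc.continuousOn).add
      (hBcont y hy0).continuousOn)).add ((hCcont.mono hsub).add (hDcont y hy0).continuousOn)
  obtain ⟨σ, hσ, hGσ⟩ := intermediate_value_Ioo hsneg.le hGc ⟨hG1, hG0⟩
  refine ⟨σ, ?_, hσ.2, ?_⟩
  · have : -ε * (Real.log y)⁻¹ < s := by rw [hsdef]; nlinarith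
    exact this.trans hσ.1
  · rw [hF y hy1 σ hσ.2.ne]
    have h4 : σ * (A σ * y ^ (a * σ + b) + B y σ) + (C σ + D y σ) = 0 := hGσ
    have h5 : σ ≠ 0 := hσ.2.ne
    have h6 : A σ * y ^ (a * σ + b) + B y σ + 1 / σ * (C σ + D y σ)
        = (σ * (A σ * y ^ (a * σ + b) + B y σ) + (C σ + D y σ)) / σ := by
      field_simp
    rw [h6, h4, zero_div]
end

section
/- (Negativity of F just to the left of 0.) Assume c = d = 0, b > 0, A(0) > 0 and C(0) > 0. Then there exists Y > 1 such that for every y > Y there exists l > 0 with F(y,σ) < 0 for all σ ∈ (−l, 0). -/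
open Real Filter Set

/-- Negativity of F just to the left of 0. -/
theorem F_negative_left_of_zero
    (a b : ℝ) (hb : 0 < b)
    (A C : ℝ → ℝ)
    (δA : ℝ) (hδA : 0 < δA)
    (hAcont : ContinuousOn A (Set.Ioo (-δA) δA))
    (hAne : ∀ σ ∈ Set.Ioo (-δA) δA, A σ ≠ 0)
    (hCcont : ContinuousOn C (Set.Ioo (-δA) δA))
    (hCne : ∀ σ ∈ Set.Ioo (-δA) δA, C σ ≠ 0)
    (hA0 : 0 < A 0) (hC0 : 0 < C 0)
    (B D : ℝ → ℝ → ℝ)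
    (hBcont : ∀ y > (0:ℝ), Continuous (fun σ => B y σ))
    (hDcont : ∀ y > (0:ℝ), Continuous (fun σ => D y σ))
    (δu : ℝ) (hδu : 0 < δu)
    (hBlim : TendstoUniformlyOn (fun y σ => B y σ * y ^ (-(a * σ + b)))
      (fun _ => 0) atTop (Set.Ioo (-δu) δu))
    (hDlim : TendstoUniformlyOn (fun y σ => D y σ)
      (fun _ => 0) atTop (Set.Ioo (-δu) δu))
    (F : ℝ → ℝ → ℝ)
    (hF : ∀ y > (1:ℝ), ∀ σ : ℝ, σ ≠ 0 →
      F y σ = A σ * y ^ (a * σ + b) + B y σ + (1 / σ) * (C σ + D y σ)) :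
    ∃ Y > (1:ℝ), ∀ y > Y, ∃ l > (0:ℝ), ∀ σ ∈ Set.Ioo (-l) (0:ℝ), F y σ < 0 := by
  have h0 : (0:ℝ) ∈ Set.Ioo (-δu) δu := ⟨by linarith, hδu⟩
  have hD0 := hDlim.tendsto_at h0
  have hev : ∀ᶠ y in atTop, -C 0 < D y 0 :=
    hD0.eventually (lt_mem_nhds (by linarith))
  obtain ⟨Y, hY⟩ := eventually_atTop.1 hev
  refine ⟨max Y 2, lt_of_lt_of_le (by norm_num) (le_max_right _ _), ?_⟩
  intro y hy
  have hyY : Y ≤ y := (le_max_left _ _).trans hy.le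
  have hy2 : 2 ≤ y := (le_max_right _ _).trans hy.le
  have hy0 : 0 < y := by linarith
  have hnA : Set.Ioo (-δA) δA ∈ nhds (0:ℝ) := Ioo_mem_nhds (by linarith) hδA
  have cA : ContinuousAt A 0 := hAcont.continuousAt hnA
  have cC : ContinuousAt C 0 := hCcont.continuousAt hnA
  have cB : ContinuousAt (fun σ => B y σ) 0 := (hBcont y hy0).continuousAt
  have cD : ContinuousAt (fun σ => D y σ) 0 := (hDcont y hy0).continuousAt
  have cp : ContinuousAt (fun σ : ℝ => y ^ (a * σ + b)) 0 := by
    apply Continuous.continuousAt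
    exact Continuous.rpow continuous_const (by fun_prop) (fun _ => Or.inl hy0.ne')
  have cg : ContinuousAt
      (fun σ : ℝ => σ * (A σ * y ^ (a * σ + b) + B y σ) + (C σ + D y σ)) 0 :=
    (continuousAt_id.mul ((cA.mul cp).add cB)).add (cC.add cD)
  have hpos : ∀ᶠ σ in nhds (0:ℝ),
      0 < σ * (A σ * y ^ (a * σ + b) + B y σ) + (C σ + D y σ) := by
    apply cg.eventually (lt_mem_nhds _)
    have := hY y hyY
    simp only [zero_mul, zero_add]
    linarith
  obtain ⟨l, hl, hball⟩ := Metric.eventually_nhds_iff.1 hpos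
  refine ⟨l, hl, ?_⟩
  intro σ hσ
  have h1 := @hball σ (by
    rw [Real.dist_eq, sub_zero, abs_of_neg hσ.2]
    linarith [hσ.1])
  rw [hF y (by linarith) σ hσ.2.ne]
  have h2 : A σ * y ^ (a * σ + b) + B y σ + (1 / σ) * (C σ + D y σ)
      = (σ * (A σ * y ^ (a * σ + b) + B y σ) + (C σ + D y σ)) / σ := by
    have := hσ.2.ne
    field_simp
  rw [h2]
  exact div_neg_of_pos_of_neg h1 hσ.2
end

section
/- (Positivity of F at σ = −ε/log y for large y.) Assume c = d = 0, b > 0, A(0) > 0 and C(0) > 0. Then for every ε > 0 there exists Y > 1 such that for every y > Y one has F(y, −ε·(log y)⁻¹) > 0. -/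
open Real Filter Set

/-- Positivity of F at σ = −ε/log y for large y. -/
theorem F_positive_at_minus_eps_over_log
    (a b : ℝ) (hb : 0 < b)
    (A C : ℝ → ℝ)
    (δA : ℝ) (hδA : 0 < δA)
    (hAcont : ContinuousOn A (Set.Ioo (-δA) δA))
    (hAne : ∀ σ ∈ Set.Ioo (-δA) δA, A σ ≠ 0)
    (hCcont : ContinuousOn C (Set.Ioo (-δA) δA))
    (hCne : ∀ σ ∈ Set.Ioo (-δA) δA, C σ ≠ 0)
    (hA0 : 0 < A 0) (hC0 : 0 < C 0)
    (B D : ℝ → ℝ → ℝ)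
    (hBcont : ∀ y > (0:ℝ), Continuous (fun σ => B y σ))
    (hDcont : ∀ y > (0:ℝ), Continuous (fun σ => D y σ))
    (δu : ℝ) (hδu : 0 < δu)
    (hBlim : TendstoUniformlyOn (fun y σ => B y σ * y ^ (-(a * σ + b)))
      (fun _ => 0) atTop (Set.Ioo (-δu) δu))
    (hDlim : TendstoUniformlyOn (fun y σ => D y σ)
      (fun _ => 0) atTop (Set.Ioo (-δu) δu))
    (F : ℝ → ℝ → ℝ)
    (hF : ∀ y > (1:ℝ), ∀ σ : ℝ, σ ≠ 0 →
      F y σ = A σ * y ^ (a * σ + b) + B y σ + (1 / σ) * (C σ + D y σ)) :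
    ∀ ε > (0:ℝ), ∃ Y > (1:ℝ), ∀ y > Y, 0 < F y (-ε * (Real.log y)⁻¹) := by
  intro ε hε
  have hσ : Tendsto (fun y : ℝ => -ε * (Real.log y)⁻¹) atTop (nhds 0) := by
    have := (tendsto_inv_atTop_zero.comp Real.tendsto_log_atTop).const_mul (-ε)
    simpa using this
  have hnA : Set.Ioo (-δA) δA ∈ nhds (0:ℝ) := Ioo_mem_nhds (by linarith) hδA
  have hnu : Set.Ioo (-δu) δu ∈ nhds (0:ℝ) := Ioo_mem_nhds (by linarith) hδu
  have hA1 := (hAcont.continuousAt hnA).tendsto.comp hσ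
  have hC1 := (hCcont.continuousAt hnA).tendsto.comp hσ
  have eA := hA1.eventually (lt_mem_nhds (show A 0 / 2 < A 0 by linarith))
  have eC := hC1.eventually (gt_mem_nhds (show C 0 < 2 * C 0 by linarith))
  have eU := hσ.eventually hnu
  have eB := Metric.tendstoUniformlyOn_iff.1 hBlim (A 0 / 4) (by linarith)
  have eD := Metric.tendstoUniformlyOn_iff.1 hDlim (C 0) hC0
  have hK : 0 < A 0 / 4 * Real.exp (-a * ε) * ε / (6 * C 0) := by positivity
  have eL := (isLittleO_log_rpow_atTop hb).bound hK
  have key : ∀ᶠ y : ℝ in atTop, 0 < F y (-ε * (Real.log y)⁻¹) := by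
    filter_upwards [eA, eC, eU, eB, eD, eL, eventually_gt_atTop (1:ℝ)]
      with y hA hC hU hB hD hL hy
    have hy0 : 0 < y := by linarith
    have hlog : 0 < Real.log y := Real.log_pos hy
    have hyb : 0 < y ^ b := Real.rpow_pos_of_pos hy0 b
    have hB := hB _ hU
    have hD := hD _ hU
    simp only [Function.comp] at hA hC
    rw [Real.norm_of_nonneg hlog.le, Real.norm_of_nonneg hyb.le] at hL
    rw [hF y hy _ (mul_ne_zero (by linarith) (inv_ne_zero hlog.ne'))]
    have hp : y ^ (a * (-ε * (Real.log y)⁻¹) + b) = Real.exp (-a * ε) * y ^ b := by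
      rw [Real.rpow_add hy0, Real.rpow_def_of_pos hy0 (a * _)]
      congr 2
      field_simp
    have hinv : 1 / (-ε * (Real.log y)⁻¹) = -(Real.log y / ε) := by
      field_simp
    rw [Real.rpow_neg hy0.le, hp] at hB
    rw [hp, hinv]
    generalize -ε * (Real.log y)⁻¹ = σ at *
    have hP : 0 < Real.exp (-a * ε) * y ^ b := by positivity
    have hL2 : Real.log y / ε * (6 * C 0) ≤ A 0 / 4 * (Real.exp (-a * ε) * y ^ b) := by
      calc Real.log y / ε * (6 * C 0) ≤ (A 0 / 4 * Real.exp (-a * ε) * ε / (6 * C 0) * y ^ b) / ε * (6 * C 0) := by gcongr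
        _ = _ := by field_simp
    generalize Real.exp (-a * ε) * y ^ b = P at *
    have hl : 0 < Real.log y / ε := by positivity
    generalize Real.log y / ε = l at *
    rw [dist_zero_left, Real.norm_eq_abs, abs_lt] at hB hD
    have hB2 : -(A 0 / 4) * P < B y σ := by
      have := hB.1
      rwa [← div_eq_mul_inv, lt_div_iff₀ hP] at this
    have h1 : A 0 / 2 * P < A σ * P := by gcongr
    have h2 : l * (C σ + D y σ) < l * (3 * C 0) := by
      apply mul_lt_mul_of_pos_left _ hl
      linarith [hD.2]
    have h3 : 0 < l * C 0 := by positivity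
    nlinarith
  obtain ⟨Y, hY⟩ := eventually_atTop.1 key
  exact ⟨max Y 2, lt_max_of_lt_right (by norm_num), fun y hy => hY y ((le_max_left _ _).trans hy.le)⟩
end

section
/- (Siegel zeros tend to zero faster than 1/log y.) Assume b > d. Fix ε > 0 and Y > 1, and let β : (Y,∞) → ℝ be any function such that for each y > Y one has β(y) ∈ (−ε·(log y)⁻¹, ε·(log y)⁻¹), β(y) ≠ 0, and F(y, β(y)) = 0. Then y^{β(y)} → 1 as y → ∞ (equivalently, β(y)·log y → 0 as y → ∞), and this limit is independent of the choice of ε and of the choice of the function β. -/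
open Real Filter Set

/-- Siegel zeros tend to zero faster than 1/log y. -/
theorem siegel_zero_faster_than_log
    (a b c d : ℝ) (hbd : b > d)
    (A C : ℝ → ℝ)
    (δA : ℝ) (hδA : 0 < δA)
    (hAcont : ContinuousOn A (Set.Ioo (-δA) δA))
    (hAne : ∀ σ ∈ Set.Ioo (-δA) δA, A σ ≠ 0)
    (hCcont : ContinuousOn C (Set.Ioo (-δA) δA))
    (hCne : ∀ σ ∈ Set.Ioo (-δA) δA, C σ ≠ 0)
    (B D : ℝ → ℝ → ℝ)
    (hBcont : ∀ y > (0:ℝ), Continuous (fun σ => B y σ))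
    (hDcont : ∀ y > (0:ℝ), Continuous (fun σ => D y σ))
    (δu : ℝ) (hδu : 0 < δu)
    (hBlim : TendstoUniformlyOn (fun y σ => B y σ * y ^ (-(a * σ + b)))
      (fun _ => 0) atTop (Set.Ioo (-δu) δu))
    (hDlim : TendstoUniformlyOn (fun y σ => D y σ * y ^ (-(c * σ + d)))
      (fun _ => 0) atTop (Set.Ioo (-δu) δu))
    (F : ℝ → ℝ → ℝ)
    (hF : ∀ y > (1:ℝ), ∀ σ : ℝ, σ ≠ 0 →
      F y σ = A σ * y ^ (a * σ + b) + B y σ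
        + (1 / σ) * (C σ * y ^ (c * σ + d) + D y σ))
    (ε : ℝ) (hε : 0 < ε) (Y : ℝ) (hY : 1 < Y)
    (β : ℝ → ℝ)
    (hβ : ∀ y > Y, -ε * (Real.log y)⁻¹ < β y ∧ β y < ε * (Real.log y)⁻¹
      ∧ β y ≠ 0 ∧ F y (β y) = 0) :
    Tendsto (fun y => y ^ β y) atTop (nhds 1)
      ∧ Tendsto (fun y => β y * Real.log y) atTop (nhds 0) := by
  have hlog : Tendsto (fun y : ℝ => (Real.log y)⁻¹) atTop (nhds 0) :=
    tendsto_inv_atTop_zero.comp Real.tendsto_log_atTop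
  have hβ0 : Tendsto β atTop (nhds 0) := by
    have h1 : Tendsto (fun y : ℝ => -ε * (Real.log y)⁻¹) atTop (nhds 0) := by
      simpa using hlog.const_mul (-ε)
    have h2 : Tendsto (fun y : ℝ => ε * (Real.log y)⁻¹) atTop (nhds 0) := by
      simpa using hlog.const_mul ε
    refine tendsto_of_tendsto_of_tendsto_of_le_of_le' h1 h2 ?_ ?_
    · filter_upwards [eventually_gt_atTop Y] with y hy using (hβ y hy).1.le
    · filter_upwards [eventually_gt_atTop Y] with y hy using (hβ y hy).2.1.le
  have hmem : ∀ᶠ y in atTop, β y ∈ Set.Ioo (-δu) δu :=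
    hβ0.eventually (Ioo_mem_nhds (by linarith) hδu)
  have key : ∀ G : ℝ → ℝ → ℝ, TendstoUniformlyOn G (fun _ => 0) atTop (Set.Ioo (-δu) δu) →
      Tendsto (fun y => G y (β y)) atTop (nhds 0) := by
    intro G hG
    rw [Metric.tendsto_nhds]
    intro e he
    filter_upwards [Metric.tendstoUniformlyOn_iff.1 hG e he, hmem] with y h1 h2
    rw [dist_comm]
    exact h1 _ h2
  have hu := key _ hBlim
  have hv := key _ hDlim
  have h0 : (0:ℝ) ∈ Set.Ioo (-δA) δA := ⟨by linarith, hδA⟩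
  have hA := ((hAcont.continuousAt (Ioo_mem_nhds h0.1 h0.2)).tendsto.comp hβ0).add hu
  have hC := ((hCcont.continuousAt (Ioo_mem_nhds h0.1 h0.2)).tendsto.comp hβ0).add hv
  simp only [Function.comp_def, add_zero] at hA hC
  have hg := hC.div hA (hAne 0 h0)
  have hL : Tendsto (fun y : ℝ => Real.log y / y ^ (b - d)) atTop (nhds 0) :=
    (isLittleO_log_rpow_atTop (by linarith : 0 < b - d)).tendsto_div_nhds_zero
  have hgL := hg.mul hL
  rw [mul_zero] at hgL
  have hbd' : ∀ᶠ y in atTop, ‖Real.exp ((c - a) * (β y * Real.log y))‖ ≤ Real.exp (|c - a| * ε) := by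
    filter_upwards [eventually_gt_atTop Y] with y hy
    obtain ⟨h1, h2, -, -⟩ := hβ y hy
    have hl : 0 < Real.log y := Real.log_pos (by linarith)
    rw [Real.norm_eq_abs, Real.abs_exp]
    apply Real.exp_le_exp.2
    have h3 : |β y * Real.log y| ≤ ε := by
      rw [abs_le]
      rw [← div_eq_mul_inv, div_lt_iff₀ hl] at h1
      rw [← div_eq_mul_inv, lt_div_iff₀ hl] at h2
      exact ⟨h1.le, h2.le⟩
    calc _ ≤ |(c - a) * (β y * Real.log y)| := le_abs_self _
      _ = |c - a| * |β y * Real.log y| := abs_mul _ _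
      _ ≤ _ := by gcongr
  have hfin := hgL.zero_mul_isBoundedUnder_le (Filter.isBoundedUnder_of_eventually_le hbd')
  have hmain : Tendsto (fun y => β y * Real.log y) atTop (nhds 0) := by
    have := hfin.neg
    rw [neg_zero] at this
    refine this.congr' ?_
    filter_upwards [eventually_gt_atTop Y, hA.eventually_ne (hAne 0 h0)] with y hy hne
    obtain ⟨-, -, hb0, hFz⟩ := hβ y hy
    have hy0 : 0 < y := by linarith
    rw [hF y (by linarith) _ hb0] at hFz
    have e1 : Real.exp ((c - a) * (β y * Real.log y)) / y ^ (b - d)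
        = y ^ (c * β y + d) / y ^ (a * β y + b) := by
      rw [Real.rpow_def_of_pos hy0, Real.rpow_def_of_pos hy0, Real.rpow_def_of_pos hy0,
        ← Real.exp_sub, ← Real.exp_sub]
      congr 1
      ring
    rw [Real.rpow_neg hy0.le] at hne
    have hp : 0 < y ^ (a * β y + b) := Real.rpow_pos_of_pos hy0 _
    have hq : 0 < y ^ (c * β y + d) := Real.rpow_pos_of_pos hy0 _
    have e2 : ∀ g : ℝ, -(g * (Real.log y / y ^ (b - d)) * Real.exp ((c - a) * (β y * Real.log y)))
        = -(g * (y ^ (c * β y + d) / y ^ (a * β y + b))) * Real.log y := by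
      intro g
      rw [← e1]; ring
    simp only [Pi.div_apply]
    rw [e2, Real.rpow_neg hy0.le, Real.rpow_neg hy0.le]
    congr 1
    generalize y ^ (a * β y + b) = p at *
    generalize y ^ (c * β y + d) = q at *
    have hne2 : A (β y) * p + B y (β y) ≠ 0 := by
      intro h
      apply hne
      field_simp
      linarith
    field_simp at hFz ⊢
    linarith
  refine ⟨?_, hmain⟩
  have := (Real.continuous_exp.tendsto 0).comp hmain
  rw [Real.exp_zero] at this
  refine this.congr' ?_
  filter_upwards [eventually_gt_atTop 0] with y hy
  rw [Real.rpow_def_of_pos hy, mul_comm]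
  rfl
end

section
/- (Refined location of the Siegel zero.) Assume c = d = 0, b > 0, A(0) > 0 and C(0) > 0. Then for every ε > 0 there exists Y > 1 such that for every y > Y there exists σ ∈ (−ε·(log y)⁻¹, 0) with F(y,σ) = 0; that is, the zero lies strictly to the left of 0. -/
open Real Filter Set

/-- Refined location of the Siegel zero: the zero lies strictly to the left of 0. -/
theorem siegel_zero_left_of_zero
    (a b : ℝ) (hb : 0 < b)
    (A C : ℝ → ℝ)
    (δA : ℝ) (hδA : 0 < δA)
    (hAcont : ContinuousOn A (Set.Ioo (-δA) δA))
    (hAne : ∀ σ ∈ Set.Ioo (-δA) δA, A σ ≠ 0)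
    (hCcont : ContinuousOn C (Set.Ioo (-δA) δA))
    (hCne : ∀ σ ∈ Set.Ioo (-δA) δA, C σ ≠ 0)
    (hA0 : 0 < A 0) (hC0 : 0 < C 0)
    (B D : ℝ → ℝ → ℝ)
    (hBcont : ∀ y > (0:ℝ), Continuous (fun σ => B y σ))
    (hDcont : ∀ y > (0:ℝ), Continuous (fun σ => D y σ))
    (δu : ℝ) (hδu : 0 < δu)
    (hBlim : TendstoUniformlyOn (fun y σ => B y σ * y ^ (-(a * σ + b)))
      (fun _ => 0) atTop (Set.Ioo (-δu) δu))
    (hDlim : TendstoUniformlyOn (fun y σ => D y σ)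
      (fun _ => 0) atTop (Set.Ioo (-δu) δu))
    (F : ℝ → ℝ → ℝ)
    (hF : ∀ y > (1:ℝ), ∀ σ : ℝ, σ ≠ 0 →
      F y σ = A σ * y ^ (a * σ + b) + B y σ + (1 / σ) * (C σ + D y σ)) :
    ∀ ε > (0:ℝ), ∃ Y > (1:ℝ), ∀ y > Y, ∃ σ : ℝ,
      -ε * (Real.log y)⁻¹ < σ ∧ σ < 0 ∧ F y σ = 0 := by
  intro ε hε
  have hmem0 : Set.Ioo (-δA) δA ∈ nhds (0:ℝ) := Ioo_mem_nhds (by linarith) hδA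
  have hmemu : Set.Ioo (-δu) δu ∈ nhds (0:ℝ) := Ioo_mem_nhds (by linarith) hδu
  have hA : ContinuousAt A 0 := hAcont.continuousAt hmem0
  have hC : ContinuousAt C 0 := hCcont.continuousAt hmem0
  have hs : Tendsto (fun y : ℝ => -(ε/2) * (Real.log y)⁻¹) atTop (nhds 0) := by
    have := (tendsto_inv_atTop_zero.comp Real.tendsto_log_atTop).const_mul (-(ε/2))
    simpa using this
  have e1 := hs.eventually hmem0
  have e2 := hs.eventually hmemu
  have e3 := hs.eventually (hA.eventually (lt_mem_nhds (show A 0 / 2 < A 0 by linarith)))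
  have e4 := hs.eventually (hC.eventually (gt_mem_nhds (show C 0 < 2 * C 0 by linarith)))
  have e5 := Metric.tendstoUniformlyOn_iff.1 hBlim (A 0 / 4) (by linarith)
  have e6 := Metric.tendstoUniformlyOn_iff.1 hDlim (C 0 / 2) (by linarith)
  set K : ℝ := (ε/2) * Real.exp (-(a * (ε/2))) * (A 0 / 4) with hK
  have hKpos : 0 < K := by positivity
  have e7 := (isLittleO_log_rpow_atTop hb).def (show 0 < K / (4 * C 0) by positivity)
  obtain ⟨Y, hY⟩ := eventually_atTop.1
    (e1.and (e2.and (e3.and (e4.and (e5.and (e6.and (e7.and (eventually_gt_atTop (1:ℝ)))))))))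
  refine ⟨max Y 2, lt_of_lt_of_le (by norm_num) (le_max_right _ _), fun y hy => ?_⟩
  obtain ⟨h1, h2, h3, h4, h5, h6, h7, h8⟩ := hY y ((le_max_left _ _).trans hy.le)
  have hy0 : 0 < y := by linarith
  have hlog : 0 < Real.log y := Real.log_pos h8
  set s : ℝ := -(ε/2) * (Real.log y)⁻¹ with hsdef
  have hli : 0 < (Real.log y)⁻¹ := inv_pos.2 hlog
  have hsneg : s < 0 := by rw [hsdef]; nlinarith
  have hsl : s * Real.log y = -(ε/2) := by rw [hsdef]; field_simp
  have h1' : s ∈ Set.Ioo (-δA) δA := h1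
  have h2' : s ∈ Set.Ioo (-δu) δu := h2
  have hB := h5 s h2'
  have hDs := h6 s h2'
  have hD0 := h6 0 ⟨by linarith, hδu⟩
  simp only [dist_zero_left, Real.norm_eq_abs] at hB hDs hD0
  rw [abs_lt] at hB hDs hD0
  have hyb : 0 < y ^ b := Real.rpow_pos_of_pos hy0 b
  rw [Real.norm_of_nonneg hlog.le, Real.norm_of_nonneg hyb.le] at h7
  have h7' : 4 * C 0 * Real.log y ≤ K * y ^ b := by
    have := mul_le_mul_of_nonneg_left h7 (show 0 ≤ 4 * C 0 by positivity)
    calc _ ≤ _ := this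
      _ = _ := by field_simp
  set P : ℝ := y ^ (a * s + b) with hP
  have hPpos : 0 < P := Real.rpow_pos_of_pos hy0 _
  have hPe : P = Real.exp (-(a * (ε/2))) * y ^ b := by
    rw [hP, Real.rpow_add hy0, Real.rpow_def_of_pos hy0]
    congr 2
    linear_combination a * hsl
  rw [Real.rpow_neg hy0.le, ← hP] at hB
  have hBP : -(A 0 / 4) * P < B y s := by
    have := mul_lt_mul_of_pos_right hB.1 hPpos
    rwa [inv_mul_cancel_right₀ hPpos.ne'] at this
  have hlow : A 0 / 4 * P < A s * P + B y s := by
    have : A 0 / 2 * P < A s * P := mul_lt_mul_of_pos_right h3 hPpos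
    linarith
  have hGs : s * (A s * P + B y s) + (C s + D y s) < 0 := by
    have k1 : s * (A s * P + B y s) < s * (A 0 / 4 * P) := mul_lt_mul_of_neg_left hlow hsneg
    have k2 : s * (A 0 / 4 * P) ≤ -(4 * C 0) := by
      have : s * (A 0 / 4 * P) = -(K * y ^ b * (Real.log y)⁻¹) := by
        rw [hPe, hK, hsdef]; ring
      rw [this]
      have := mul_le_mul_of_nonneg_right h7' hli.le
      rw [mul_inv_cancel_right₀ hlog.ne'] at this
      linarith
    have h4' : C s < 2 * C 0 := h4
    linarith [hDs.2]
  have hsub : Set.Icc s 0 ⊆ Set.Ioo (-δA) δA := fun x hx =>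
    ⟨h1'.1.trans_le hx.1, hx.2.trans_lt hδA⟩
  have hcont : ContinuousOn
      (fun x => x * (A x * y ^ (a * x + b) + B y x) + (C x + D y x)) (Set.Icc s 0) := by
    have c1 := hAcont.mono hsub
    have c2 := hCcont.mono hsub
    have c3 := (hBcont y hy0).continuousOn (s := Set.Icc s 0)
    have c4 := (hDcont y hy0).continuousOn (s := Set.Icc s 0)
    have c5 : ContinuousOn (fun x : ℝ => y ^ (a * x + b)) (Set.Icc s 0) :=
      (Continuous.rpow continuous_const (by fun_prop) (fun _ => Or.inl hy0.ne')).continuousOn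
    exact (continuousOn_id.mul ((c1.mul c5).add c3)).add (c2.add c4)
  have hG0 : 0 < C 0 + D y 0 := by linarith [hD0.1]
  obtain ⟨x, hx, hx0⟩ := intermediate_value_Icc hsneg.le hcont
    (show (0:ℝ) ∈ Set.Icc _ _ from ⟨hGs.le, by simpa using hG0.le⟩)
  have hx0' : x * (A x * y ^ (a * x + b) + B y x) + (C x + D y x) = 0 := hx0
  have hxne : x ≠ 0 := by
    rintro rfl
    rw [zero_mul, zero_add] at hx0'
    linarith
  refine ⟨x, lt_of_lt_of_le ?_ hx.1, lt_of_le_of_ne hx.2 hxne, ?_⟩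
  · rw [hsdef]; nlinarith
  · rw [hF y h8 x hxne]
    have : C x + D y x = -(x * (A x * y ^ (a * x + b) + B y x)) := by linarith
    rw [this]
    field_simp
    ring
end

section
/- (Discrete, function-field style, version of the existence of Siegel zeros.) Fix a real number q > 1 and assume b > d. Then for every ε > 0 there exists a natural number N such that for every natural number n > N there exists a real number σ with −ε·(n·log q)⁻¹ < σ < ε·(n·log q)⁻¹, σ ≠ 0, and F(qⁿ, σ) = 0. -/
open Real Filter Set

lemma unif_aux (f : ℝ → ℝ → ℝ) (δ : ℝ)
    (h : TendstoUniformlyOn f (fun _ => 0) atTop (Set.Ioo (-δ) δ))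
    (y σ : ℕ → ℝ) (hy : Tendsto y atTop atTop)
    (hσ : ∀ᶠ n in atTop, σ n ∈ Set.Ioo (-δ) δ) :
    Tendsto (fun n => f (y n) (σ n)) atTop (nhds 0) := by
  rw [Metric.tendsto_nhds]
  intro e he
  rw [Metric.tendstoUniformlyOn_iff] at h
  filter_upwards [hy.eventually (h e he), hσ] with n h1 h2
  rw [dist_comm]
  exact h1 _ h2

/-- Discrete (function-field style) version of the existence of Siegel zeros. -/
theorem siegel_zero_existence_discrete
    (q : ℝ) (hq : 1 < q)
    (a b c d : ℝ) (hbd : b > d)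
    (A C : ℝ → ℝ)
    (δA : ℝ) (hδA : 0 < δA)
    (hAcont : ContinuousOn A (Set.Ioo (-δA) δA))
    (hAne : ∀ σ ∈ Set.Ioo (-δA) δA, A σ ≠ 0)
    (hCcont : ContinuousOn C (Set.Ioo (-δA) δA))
    (hCne : ∀ σ ∈ Set.Ioo (-δA) δA, C σ ≠ 0)
    (B D : ℝ → ℝ → ℝ)
    (hBcont : ∀ y > (0:ℝ), Continuous (fun σ => B y σ))
    (hDcont : ∀ y > (0:ℝ), Continuous (fun σ => D y σ))
    (δu : ℝ) (hδu : 0 < δu)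
    (hBlim : TendstoUniformlyOn (fun y σ => B y σ * y ^ (-(a * σ + b)))
      (fun _ => 0) atTop (Set.Ioo (-δu) δu))
    (hDlim : TendstoUniformlyOn (fun y σ => D y σ * y ^ (-(c * σ + d)))
      (fun _ => 0) atTop (Set.Ioo (-δu) δu))
    (F : ℝ → ℝ → ℝ)
    (hF : ∀ y > (1:ℝ), ∀ σ : ℝ, σ ≠ 0 →
      F y σ = A σ * y ^ (a * σ + b) + B y σ
        + (1 / σ) * (C σ * y ^ (c * σ + d) + D y σ)) :
    ∀ ε > (0:ℝ), ∃ N : ℕ, ∀ n : ℕ, n > N → ∃ σ : ℝ,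
      -ε * ((n : ℝ) * Real.log q)⁻¹ < σ ∧ σ < ε * ((n : ℝ) * Real.log q)⁻¹
        ∧ σ ≠ 0 ∧ F (q ^ n) σ = 0 := by
  intro ε hε
  have hlq : 0 < Real.log q := Real.log_pos hq
  have hq0 : 0 < q := by linarith
  have m0 : (0:ℝ) ∈ Set.Ioo (-δA) δA := ⟨by linarith, hδA⟩
  have hA0 := hAne 0 m0
  have hC0 := hCne 0 m0
  obtain ⟨s, hs1, hs⟩ : ∃ s : ℝ, |s| = 1 ∧ s * A 0 * C 0 < 0 := by
    rcases lt_or_gt_of_ne (mul_ne_zero hA0 hC0) with h | h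
    · exact ⟨1, by simp, by linarith⟩
    · exact ⟨-1, by simp, by linarith⟩
  set η := ε / 2 with hη
  have hη0 : 0 < η := by positivity
  set L : ℕ → ℝ := fun n => (n : ℝ) * Real.log q with hL
  have hLt : Tendsto L atTop atTop :=
    tendsto_natCast_atTop_atTop.atTop_mul_const hlq
  set y : ℕ → ℝ := fun n => q ^ n with hy
  have hyt : Tendsto y atTop atTop := tendsto_pow_atTop_atTop_of_one_lt hq
  have hy0 : ∀ n, 0 < y n := fun n => pow_pos hq0 n
  have hyL : ∀ n p, (y n) ^ p = Real.exp (L n * p) := by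
    intro n p
    rw [Real.rpow_def_of_pos (hy0 n)]
    simp [hy, hL, Real.log_pow]
  set σ : ℕ → ℝ := fun n => s * η / L n with hσ
  have hσt : Tendsto σ atTop (nhds 0) := tendsto_const_nhds.div_atTop hLt
  have hIoo : ∀ δ : ℝ, 0 < δ → ∀ᶠ n in atTop, σ n ∈ Set.Ioo (-δ) δ := fun δ hδ =>
    hσt.eventually (Ioo_mem_nhds (by linarith) hδ)
  have hβ := unif_aux _ _ hBlim y σ hyt (hIoo δu hδu)
  have hγ := unif_aux _ _ hDlim y σ hyt (hIoo δu hδu)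
  have hγ0 := unif_aux _ _ hDlim y (fun _ => 0) hyt
    (Eventually.of_forall fun _ => ⟨by linarith, hδu⟩)
  have nA := Ioo_mem_nhds m0.1 m0.2
  have hAt : Tendsto (fun n => A (σ n)) atTop (nhds (A 0)) :=
    (hAcont.continuousAt nA).tendsto.comp hσt
  have hCt : Tendsto (fun n => C (σ n)) atTop (nhds (C 0)) :=
    (hCcont.continuousAt nA).tendsto.comp hσt
  have hbig : Tendsto (fun n => Real.exp ((b - d) * L n) / L n) atTop atTop := by
    have := (tendsto_exp_mul_div_rpow_atTop 1 (b - d) (by linarith)).comp hLt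
    simpa [Function.comp_def] using this
  have hneg : Tendsto (fun n => Real.exp ((b - d) * L n) / L n *
      (η * Real.exp (a * (s * η)) * (s * (A (σ n) + B (y n) (σ n) * y n ^ (-(a * σ n + b))) * C 0)))
      atTop atBot := by
    refine hbig.atTop_mul_neg (C := η * Real.exp (a * (s * η)) * (s * (A 0 + 0) * C 0)) ?_ ?_
    · rw [add_zero]
      exact mul_neg_of_pos_of_neg (by positivity) hs
    · exact (((hAt.add hβ).const_mul s).mul_const _).const_mul _
  have hbdd : Tendsto (fun n => Real.exp (c * (s * η)) *
      (C (σ n) + D (y n) (σ n) * y n ^ (-(c * σ n + d))) * C 0) atTop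
      (nhds (Real.exp (c * (s * η)) * (C 0 + 0) * C 0)) :=
    ((hCt.add hγ).const_mul _).mul_const _
  have hsum := hneg.atBot_add hbdd
  have hzero : Tendsto (fun n => (C 0 + D (y n) 0 * y n ^ (-(c * 0 + d))) * C 0) atTop
      (nhds ((C 0 + 0) * C 0)) := (tendsto_const_nhds.add hγ0).mul_const _
  have hpos : (0:ℝ) < (C 0 + 0) * C 0 := by
    rw [add_zero]; exact mul_self_pos.mpr hC0
  have hev := (hsum.eventually (eventually_lt_atBot 0)).and
    ((hzero.eventually (eventually_gt_nhds hpos)).and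
    ((hIoo δA hδA).and ((hLt.eventually (eventually_gt_atTop 0)).and
    (hyt.eventually (eventually_gt_atTop 1)))))
  obtain ⟨N, hN⟩ := eventually_atTop.mp hev
  refine ⟨N, fun n hn => ?_⟩
  obtain ⟨h1, h2, h3, h4, h5⟩ := hN n hn.le
  set G : ℝ → ℝ := fun t => (t * (A t * y n ^ (a * t + b) + B (y n) t)
    + (C t * y n ^ (c * t + d) + D (y n) t)) * C 0 with hG
  have hG0 : 0 < G 0 := by
    have e : G 0 = y n ^ d * ((C 0 + D (y n) 0 * y n ^ (-(c * 0 + d))) * C 0) := by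
      have : y n ^ d * y n ^ (-d) = 1 := by
        rw [← Real.rpow_add (hy0 n)]; simp
      simp only [hG, mul_zero, zero_add, zero_mul]
      linear_combination (-(D (y n) 0 * C 0)) * this
    rw [e]
    exact mul_pos (Real.rpow_pos_of_pos (hy0 n) _) h2
  have hGσ : G (σ n) < 0 := by
    have hLσ : L n * σ n = s * η := by
      simp only [hσ]; field_simp
    have e1 : y n ^ (a * σ n + b) * y n ^ (-(a * σ n + b)) = 1 := by
      rw [← Real.rpow_add (hy0 n)]; simp
    have e2 : y n ^ (c * σ n + d) * y n ^ (-(c * σ n + d)) = 1 := by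
      rw [← Real.rpow_add (hy0 n)]; simp
    have e3 : y n ^ (a * σ n + b) =
        y n ^ d * (Real.exp ((b - d) * L n) * Real.exp (a * (s * η))) := by
      rw [hyL, hyL, ← Real.exp_add, ← Real.exp_add, ← hLσ]; congr 1; ring
    have e4 : y n ^ (c * σ n + d) = y n ^ d * Real.exp (c * (s * η)) := by
      rw [hyL, hyL, ← Real.exp_add, ← hLσ]; congr 1; ring
    have e5 : Real.exp ((b - d) * L n) / L n * (η * s) = Real.exp ((b - d) * L n) * σ n := by
      simp only [hσ]; ring
    have e : G (σ n) = y n ^ d * (Real.exp ((b - d) * L n) / L n *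
      (η * Real.exp (a * (s * η)) * (s * (A (σ n) + B (y n) (σ n) * y n ^ (-(a * σ n + b))) * C 0))
      + Real.exp (c * (s * η)) *
      (C (σ n) + D (y n) (σ n) * y n ^ (-(c * σ n + d))) * C 0) := by
      have f1 : G (σ n) = (σ n * (y n ^ (a * σ n + b) *
          (A (σ n) + B (y n) (σ n) * y n ^ (-(a * σ n + b))))
          + y n ^ (c * σ n + d) * (C (σ n) + D (y n) (σ n) * y n ^ (-(c * σ n + d)))) * C 0 := by
        simp only [hG]
        linear_combination (-(σ n * B (y n) (σ n) * C 0)) * e1 - (D (y n) (σ n) * C 0) * e2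
      rw [f1]
      generalize y n ^ (-(a * σ n + b)) = u
      generalize y n ^ (-(c * σ n + d)) = v
      rw [e3, e4]
      linear_combination (-(y n ^ d * Real.exp (a * (s * η)) *
        (A (σ n) + B (y n) (σ n) * u) * C 0)) * e5
    rw [e]
    exact mul_neg_of_pos_of_neg (Real.rpow_pos_of_pos (hy0 n) _) h1
  have hsub : Set.uIcc 0 (σ n) ⊆ Set.Ioo (-δA) δA := Set.ordConnected_Ioo.uIcc_subset m0 h3
  have hrp : ∀ p r : ℝ, Continuous fun t : ℝ => y n ^ (p * t + r) := fun p r =>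
    Continuous.rpow continuous_const (by fun_prop) fun _ => Or.inl (hy0 n).ne'
  have hGc : ContinuousOn G (Set.uIcc 0 (σ n)) := by
    have k1 := hAcont.mono hsub
    have k2 := hCcont.mono hsub
    exact ((continuousOn_id.mul ((k1.mul (hrp a b).continuousOn).add
      (hBcont _ (hy0 n)).continuousOn)).add ((k2.mul (hrp c d).continuousOn).add
      (hDcont _ (hy0 n)).continuousOn)).mul continuousOn_const
  obtain ⟨t, ht, hGt⟩ := intermediate_value_uIcc hGc
    (Set.mem_uIcc.mpr (Or.inr ⟨hGσ.le, hG0.le⟩) : (0:ℝ) ∈ Set.uIcc (G 0) (G (σ n)))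
  have ht0 : t ≠ 0 := by
    rintro rfl; exact hG0.ne' hGt
  have habs : |t| < ε * (L n)⁻¹ := by
    have : |t| ≤ |σ n| := by
      have := Set.abs_sub_left_of_mem_uIcc ht
      simpa using this
    have e : |σ n| = η * (L n)⁻¹ := by
      simp only [hσ]
      rw [abs_div, abs_mul, hs1, abs_of_pos hη0, abs_of_pos h4]; ring
    rw [e] at this
    have : η * (L n)⁻¹ < ε * (L n)⁻¹ :=
      mul_lt_mul_of_pos_right (by linarith) (inv_pos.mpr h4)
    linarith
  rw [abs_lt] at habs
  refine ⟨t, by linarith [habs.1], habs.2, ht0, ?_⟩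
  rw [hF _ h5 t ht0]
  have hz : t * (A t * y n ^ (a * t + b) + B (y n) t)
    + (C t * y n ^ (c * t + d) + D (y n) t) = 0 :=
    (mul_eq_zero.mp hGt).resolve_right hC0
  apply mul_left_cancel₀ ht0
  rw [mul_zero, mul_add, ← mul_assoc t (1 / t), mul_one_div_cancel ht0, one_mul]
  exact hz
end

section
/- (Siegel zero of the constant term of the GL(2) real-analytic Eisenstein series.) For every ε > 0 there exists Y > e such that for every real y > Y there exists a real number β with 1 − ε·(log y)⁻¹ < β < 1 and G(y, β) = 0. -/
open Real Filter Set Complex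

lemma aux_real (x : ℝ) (hx : 0 < x) :
    completedRiemannZeta (x : ℂ) = (((completedRiemannZeta (x : ℂ)).re : ℝ) : ℂ) := by
  have h0 : (x : ℂ) ≠ 0 := by exact_mod_cast hx.ne'
  have hg : Gammaℝ (x : ℂ) ≠ 0 := Gammaℝ_ne_zero_of_re_pos (by simpa using hx)
  have h1 : completedRiemannZeta (x : ℂ) = riemannZeta x * Gammaℝ x := by
    rw [riemannZeta_def_of_ne_zero h0, div_mul_cancel₀ _ hg]
  have h2 : (starRingEnd ℂ) (riemannZeta x) = riemannZeta x := by
    rw [← riemannZeta_conj, conj_ofReal]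
  have h3 : Gammaℝ (x : ℂ) = ((π ^ (-x / 2) * Real.Gamma (x / 2) : ℝ) : ℂ) := by
    rw [Gammaℝ_def]
    push_cast
    rw [ofReal_cpow Real.pi_pos.le, ← Complex.Gamma_ofReal]
    push_cast
    rfl
  symm
  rw [← conj_eq_iff_re, h1, map_mul, h2, h3, conj_ofReal]

lemma aux_two : 0 < (completedRiemannZeta (2 : ℂ)).re := by
  have hg : Gammaℝ (2 : ℂ) ≠ 0 := Gammaℝ_ne_zero_of_re_pos (by simp)
  have h1 : completedRiemannZeta (2 : ℂ) = riemannZeta 2 * Gammaℝ 2 := by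
    rw [riemannZeta_def_of_ne_zero two_ne_zero, div_mul_cancel₀ _ hg]
  have h2 : completedRiemannZeta (2 : ℂ) = ((π ^ 2 / 6 * π⁻¹ : ℝ) : ℂ) := by
    rw [h1, riemannZeta_two, Gammaℝ_def]
    simp [cpow_neg_one]
  rw [h2, ofReal_re]
  positivity

lemma aux_exists : ∃ (a b : ℝ → ℝ) (δ c : ℝ), 0 < δ ∧ δ ≤ 1/4 ∧ 0 < c ∧
    ContinuousOn a (Icc 0 (1/4)) ∧ ContinuousOn b (Icc 0 (1/4)) ∧ b 0 = -1 ∧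
    (∀ t ∈ Icc 0 δ, c ≤ a t ∧ -2 ≤ b t) ∧
    (∀ t ∈ Ioc 0 δ, completedRiemannZeta (2 - 2 * (t : ℂ)) = (a t : ℂ) ∧
      2 * (t : ℂ) * completedRiemannZeta (2 * (t : ℂ)) = (b t : ℂ)) := by
  set a : ℝ → ℝ := fun t => (completedRiemannZeta (2 - 2 * (t : ℂ))).re with ha
  set b : ℝ → ℝ := fun t => 2 * t * (completedRiemannZeta₀ (2 * (t : ℂ))).re - 1
    - 2 * t / (1 - 2 * t) with hb
  have hac : ContinuousOn a (Icc 0 (1/4)) := by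
    intro t ht
    apply ContinuousAt.continuousWithinAt
    have hd : ContinuousAt completedRiemannZeta (2 - 2 * (t : ℂ)) := by
      apply (differentiableAt_completedZeta ?_ ?_).continuousAt
      · intro h
        have := congrArg Complex.re h
        simp at this
        linarith [ht.2]
      · intro h
        have := congrArg Complex.re h
        simp at this
        linarith [ht.2]
    exact Complex.continuous_re.continuousAt.comp
      (ContinuousAt.comp (f := fun t : ℝ => (2 - 2 * (t : ℂ))) hd (by fun_prop))
  have hbc : ContinuousOn b (Icc 0 (1/4)) := by
    have h0 : Continuous fun t : ℝ => (completedRiemannZeta₀ (2 * (t : ℂ))).re :=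
      Complex.continuous_re.comp (differentiable_completedZeta₀.continuous.comp (by fun_prop))
    refine ContinuousOn.sub (by fun_prop) (ContinuousOn.div (by fun_prop) (by fun_prop) ?_)
    intro t ht
    have := ht.2
    linarith
  have ha0 : 0 < a 0 := by simpa [ha] using aux_two
  have hb0 : b 0 = -1 := by simp [hb]
  have h0m : (0 : ℝ) ∈ Icc (0 : ℝ) (1/4) := by norm_num
  have e1 := (hac 0 h0m).eventually (lt_mem_nhds (show a 0 / 2 < a 0 by linarith))
  have e2 := (hbc 0 h0m).eventually (lt_mem_nhds (show -2 < b 0 by rw [hb0]; norm_num))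
  obtain ⟨r, hr, hr'⟩ := Metric.mem_nhdsWithin_iff.1 (e1.and e2)
  refine ⟨a, b, min (r/2) (1/4), a 0 / 2, by positivity, min_le_right _ _, by positivity,
    hac, hbc, hb0, ?_, ?_⟩
  · intro t ht
    have h1 := ht.2.trans (min_le_left _ _)
    have h2 := ht.2.trans (min_le_right _ _)
    have := @hr' t ⟨by rw [Metric.mem_ball, Real.dist_eq, sub_zero, abs_of_nonneg ht.1]; linarith,
      ht.1, h2⟩
    exact ⟨this.1.le, this.2.le⟩
  · intro t ht
    have h2 := ht.2.trans (min_le_right _ _)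
    have h1 := ht.1
    constructor
    · have := aux_real (2 - 2 * t) (by linarith)
      push_cast at this
      exact this
    · have := aux_real (2 * t) (by linarith)
      push_cast at this
      rw [this]
      have h3 : (completedRiemannZeta (2 * (t : ℂ))).re =
          (completedRiemannZeta₀ (2 * (t : ℂ))).re - 1 / (2 * t) - 1 / (1 - 2 * t) := by
        rw [completedRiemannZeta_eq]
        have e : (1 / (2 * (t : ℂ))) = ((1 / (2 * t) : ℝ) : ℂ) := by push_cast; rfl
        have e' : (1 / (1 - 2 * (t : ℂ))) = ((1 / (1 - 2 * t) : ℝ) : ℂ) := by push_cast; rfl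
        rw [sub_re, sub_re, e, e', ofReal_re, ofReal_re]
      rw [h3]
      have : b t = 2 * t * ((completedRiemannZeta₀ (2 * (t : ℂ))).re - 1 / (2 * t)
          - 1 / (1 - 2 * t)) := by
        have h4 : 1 - 2 * t ≠ 0 := by linarith
        simp only [hb]
        field_simp
      rw [this]
      push_cast
      rfl

/-- Siegel zero of the constant term `G(y,s) = y^s + (Λ(2s−1)/Λ(2s))·y^{1−s}`
of the GL(2) real-analytic Eisenstein series. -/
theorem siegel_zero_constant_term_GL2
    (G : ℝ → ℝ → ℂ)
    (hG : ∀ y > (0:ℝ), ∀ s : ℝ, (1:ℝ)/2 < s → s < 1 →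
      G y s = (y : ℂ) ^ (s : ℂ)
        + (completedRiemannZeta (2 * (s : ℂ) - 1) / completedRiemannZeta (2 * (s : ℂ)))
          * (y : ℂ) ^ ((1 : ℂ) - (s : ℂ))) :
    ∀ ε > (0:ℝ), ∃ Y > Real.exp 1, ∀ y > Y, ∃ β : ℝ,
      1 - ε * (Real.log y)⁻¹ < β ∧ β < 1 ∧ G y β = 0 := by
  intro ε hε
  obtain ⟨a, b, δ, c, hδ, hδ4, hc, hac, hbc, hb0, hab, hval⟩ := aux_exists
  have hE : ∀ᶠ y : ℝ in atTop, ε / 2 / Real.log y < δ ∧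
      2 < Real.exp (-ε) * c * ε * (y / Real.log y) := by
    have t1 : Tendsto (fun y => ε / 2 / Real.log y) atTop (nhds 0) :=
      Tendsto.div_atTop tendsto_const_nhds Real.tendsto_log_atTop
    have t2 : Tendsto (fun y : ℝ => y / Real.log y) atTop atTop := by
      have := (Real.tendsto_exp_div_pow_atTop 1).comp Real.tendsto_log_atTop
      refine this.congr' ?_
      filter_upwards [eventually_gt_atTop 0] with y hy
      simp [Real.exp_log hy]
    have t3 := t2.const_mul_atTop (show 0 < Real.exp (-ε) * c * ε by positivity)
    exact (t1.eventually (gt_mem_nhds hδ)).and (t3.eventually_gt_atTop 2)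
  obtain ⟨Y₀, hY₀⟩ := eventually_atTop.1 hE
  refine ⟨max Y₀ (Real.exp 1 + 1), lt_of_lt_of_le (by linarith) (le_max_right _ _), ?_⟩
  intro y hy
  obtain ⟨hy1, hy2⟩ := hY₀ y ((le_max_left _ _).trans hy.le)
  have hye : Real.exp 1 < y := by linarith [(le_max_right Y₀ (Real.exp 1 + 1)).trans_lt hy]
  have hy0 : 0 < y := (Real.exp_pos 1).trans hye
  have hl : 0 < Real.log y := by
    have := (Real.lt_log_iff_exp_lt hy0).2 hye
    linarith
  set t1 := ε / 2 / Real.log y with ht1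
  have ht1p : 0 < t1 := by positivity
  have hsub : Icc 0 t1 ⊆ Icc (0:ℝ) (1/4) := Icc_subset_Icc le_rfl (by linarith)
  have hcont : ContinuousOn (fun t => y ^ (1 - 2 * t) * a t * (2 * t) + b t) (Icc 0 t1) := by
    have h1 : Continuous fun t : ℝ => y ^ (1 - 2 * t) :=
      continuous_const.rpow (by fun_prop) (fun _ => Or.inl hy0.ne')
    exact ((h1.continuousOn.mul (hac.mono hsub)).mul (by fun_prop)).add (hbc.mono hsub)
  have hpos : 0 < y ^ (1 - 2 * t1) * a t1 * (2 * t1) + b t1 := by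
    obtain ⟨h1, h2⟩ := hab t1 ⟨ht1p.le, hy1.le⟩
    have e1 : y ^ (1 - 2 * t1) = y * Real.exp (-ε) := by
      rw [Real.rpow_def_of_pos hy0]
      have : Real.log y * (1 - 2 * t1) = Real.log y + -ε := by
        rw [ht1]; field_simp; ring
      rw [this, Real.exp_add, Real.exp_log hy0]
    have e2 : y * Real.exp (-ε) * c * (2 * t1) = Real.exp (-ε) * c * ε * (y / Real.log y) := by
      rw [ht1]; field_simp
    have e3 : y * Real.exp (-ε) * c * (2 * t1) ≤ y * Real.exp (-ε) * a t1 * (2 * t1) := by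
      gcongr
    rw [e1]
    linarith
  obtain ⟨t, ⟨ht0, htt⟩, hz⟩ := intermediate_value_Icc ht1p.le hcont
    (show (0:ℝ) ∈ Icc _ _ from ⟨by simp [hb0], hpos.le⟩)
  have htp : 0 < t := by
    rcases ht0.eq_or_lt with h | h
    · subst h
      simp [hb0] at hz
    · exact h
  have htδ : t ≤ δ := htt.trans hy1.le
  refine ⟨1 - t, ?_, by linarith, ?_⟩
  · have : ε * (Real.log y)⁻¹ = 2 * t1 := by rw [ht1]; field_simp
    rw [this]; linarith
  · rw [hG y hy0 (1 - t) (by linarith) (by linarith)]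
    obtain ⟨v1, v2⟩ := hval t ⟨htp, htδ⟩
    have hapos : 0 < a t := hc.trans_le (hab t ⟨ht0, htδ⟩).1
    have hB : completedRiemannZeta (2 * (t : ℂ)) = ((b t / (2 * t) : ℝ) : ℂ) := by
      have : (t : ℂ) ≠ 0 := by exact_mod_cast htp.ne'
      push_cast
      rw [← v2]
      field_simp
    have r1 : 2 * ((1 - t : ℝ) : ℂ) - 1 = 1 - 2 * (t : ℂ) := by push_cast; ring
    have r2 : 2 * ((1 - t : ℝ) : ℂ) = 2 - 2 * (t : ℂ) := by push_cast; ring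
    have r3 : (1 : ℂ) - ((1 - t : ℝ) : ℂ) = (t : ℂ) := by push_cast; ring
    rw [r1, r2, r3, completedRiemannZeta_one_sub, v1, hB, ← ofReal_cpow hy0.le,
      ← ofReal_cpow hy0.le]
    norm_cast
    have hs : y ^ (1 - t) = y ^ (1 - 2 * t) * y ^ t := by
      rw [← Real.rpow_add hy0]; congr 1; ring
    have hz' : b t = - (y ^ (1 - 2 * t) * a t * (2 * t)) := by
      simp only at hz
      linarith
    rw [hs, hz']
    field_simp
    ring
end

section
/- (Bateman–Grosswald asymptotic for the Siegel zero of the constant term.) Fix ε > 0 and Y > e such that for every y > Y the function G(y,·) has a zero in (1 − ε·(log y)⁻¹, 1). Let β : (Y,∞) → ℝ be any function such that for each y > Y one has β(y) ∈ (1 − ε·(log y)⁻¹, 1) and G(y, β(y)) = 0. Then 1 − β(y) ∼ 3/(π·y) as y → ∞; that is, the limit as y → ∞ of (1 − β(y))·(π·y/3) equals 1. -/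
open Real Filter Set Complex

/-- Bateman–Grosswald asymptotic for the Siegel zero of the constant term:
`1 − β(y) ∼ 3/(π·y)` as `y → ∞`. -/
theorem bateman_grosswald_asymptotic
    (G : ℝ → ℝ → ℂ)
    (hG : ∀ y > (0:ℝ), ∀ s : ℝ, (1:ℝ)/2 < s → s < 1 →
      G y s = (y : ℂ) ^ (s : ℂ)
        + (completedRiemannZeta (2 * (s : ℂ) - 1) / completedRiemannZeta (2 * (s : ℂ)))
          * (y : ℂ) ^ ((1 : ℂ) - (s : ℂ)))
    (ε : ℝ) (hε : 0 < ε) (Y : ℝ) (hY : Real.exp 1 < Y)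
    (hzero : ∀ y > Y, ∃ s : ℝ, 1 - ε * (Real.log y)⁻¹ < s ∧ s < 1 ∧ G y s = 0)
    (β : ℝ → ℝ)
    (hβ : ∀ y > Y, 1 - ε * (Real.log y)⁻¹ < β y ∧ β y < 1 ∧ G y (β y) = 0) :
    Tendsto (fun y => (1 - β y) * (Real.pi * y / 3)) atTop (nhds 1) := by
  have hlog : Tendsto Real.log atTop atTop := Real.tendsto_log_atTop
  have hel : Tendsto (fun y => ε * (Real.log y)⁻¹) atTop (nhds 0) := by
    simpa using (tendsto_inv_atTop_zero.comp hlog).const_mul ε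
  have hYev : ∀ᶠ y in atTop, Y < y := eventually_gt_atTop Y
  have hβ1 : Tendsto β atTop (nhds 1) := by
    have h1 : Tendsto (fun y => 1 - ε * (Real.log y)⁻¹) atTop (nhds 1) := by
      simpa using hel.const_sub 1
    refine tendsto_of_tendsto_of_tendsto_of_le_of_le' h1 tendsto_const_nhds ?_ ?_
    · filter_upwards [hYev] with y hy using (hβ y hy).1.le
    · filter_upwards [hYev] with y hy using (hβ y hy).2.1.le
  have hβc : Tendsto (fun y => (β y : ℂ)) atTop (nhds 1) := by
    have := (Complex.continuous_ofReal.tendsto 1).comp hβ1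
    simpa [Function.comp_def] using this
  have hA : Tendsto (fun y => (2 * (β y : ℂ) - 1 - 1) * completedRiemannZeta (2 * (β y : ℂ) - 1))
      atTop (nhds 1) := by
    refine completedRiemannZeta_residue_one.comp (f := fun y => 2 * (β y : ℂ) - 1) ?_
    refine tendsto_nhdsWithin_iff.2 ⟨?_, ?_⟩
    · have := (hβc.const_mul 2).sub_const 1
      convert this using 2
      norm_num
    · filter_upwards [hYev] with y hy
      have h := (hβ y hy).2.1
      intro h2
      have h3 : (2 * (β y : ℂ) - 1) = 1 := h2
      have h4 : 2 * β y - 1 = 1 := by exact_mod_cast h3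
      linarith
  have hL2 : completedRiemannZeta 2 = (π : ℂ) / 6 := by
    have h := riemannZeta_def_of_ne_zero (s := 2) two_ne_zero
    rw [riemannZeta_two, Complex.Gammaℝ_def] at h
    have hpi : (π : ℂ) ≠ 0 := by exact_mod_cast Real.pi_ne_zero
    norm_num [Complex.cpow_neg_one] at h
    field_simp at h ⊢
    linear_combination -h
  have hpi : (π : ℂ) ≠ 0 := by exact_mod_cast Real.pi_ne_zero
  have hB : Tendsto (fun y => completedRiemannZeta (2 * (β y : ℂ))) atTop (nhds ((π : ℂ) / 6)) := by
    rw [← hL2]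
    have hc : ContinuousAt completedRiemannZeta 2 :=
      (differentiableAt_completedZeta (by norm_num) (by norm_num)).continuousAt
    refine hc.tendsto.comp ?_
    simpa using hβc.const_mul 2
  have hB0 : ∀ᶠ y in atTop, completedRiemannZeta (2 * (β y : ℂ)) ≠ 0 :=
    hB.eventually_ne (by simp [hpi])
  have hQ := hA.div hB (by simp [hpi])
  have hu : Tendsto (fun y => (1 - β y) * y * Real.exp (-(2 * ((1 - β y) * Real.log y))))
      atTop (nhds (3 / π)) := by
    have hre := (Complex.continuous_re.tendsto _).comp hQ
    have hval : (1 / ((π : ℂ) / 6)).re = 6 / π := by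
      have : (1 / ((π : ℂ) / 6)) = ((6 / π : ℝ) : ℂ) := by push_cast; field_simp
      rw [this, Complex.ofReal_re]
    rw [hval] at hre
    have h2 := hre.div_const 2
    have e : 6 / π / 2 = 3 / π := by ring
    rw [e] at h2
    refine h2.congr' ?_
    filter_upwards [hYev, hB0, hβ1.eventually (lt_mem_nhds (show (1:ℝ)/2 < 1 by norm_num))]
      with y hy hb hs
    have hy0 : 0 < y := (Real.exp_pos 1).trans (hY.trans hy)
    obtain ⟨-, hb1, hz⟩ := hβ y hy
    rw [hG y hy0 _ hs hb1] at hz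
    have e1 : (y : ℂ) ^ (β y : ℂ) = ((y ^ β y : ℝ) : ℂ) := (Complex.ofReal_cpow hy0.le _).symm
    have e2 : (y : ℂ) ^ ((1 : ℂ) - (β y : ℂ)) = ((y ^ (1 - β y) : ℝ) : ℂ) := by
      rw [Complex.ofReal_cpow hy0.le]; push_cast; rfl
    rw [e1, e2] at hz
    have hp : 0 < y ^ (1 - β y) := Real.rpow_pos_of_pos hy0 _
    have e3 : y ^ β y = y * Real.exp (-(2 * ((1 - β y) * Real.log y))) * y ^ (1 - β y) := by
      rw [Real.rpow_def_of_pos hy0, Real.rpow_def_of_pos hy0]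
      have e0 : ∀ t : ℝ, y * Real.exp t = Real.exp (Real.log y + t) := by
        intro t
        rw [Real.exp_add, Real.exp_log hy0]
      rw [e0, ← Real.exp_add]
      congr 1; ring
    rw [e3] at hz
    have hpc : ((y ^ (1 - β y) : ℝ) : ℂ) ≠ 0 := by exact_mod_cast hp.ne'
    generalize Real.exp (-(2 * ((1 - β y) * Real.log y))) = E at *
    have e4 : completedRiemannZeta (2 * (β y : ℂ) - 1) / completedRiemannZeta (2 * (β y : ℂ))
        = -((y * E : ℝ) : ℂ) := by
      apply mul_right_cancel₀ hpc
      rw [Complex.ofReal_mul (y * E)] at hz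
      linear_combination hz
    simp only [Function.comp_apply, Pi.div_apply]
    rw [mul_div_assoc, e4]
    have e5 : (2 * (β y : ℂ) - 1 - 1) * -((y * E : ℝ) : ℂ)
        = ((2 * ((1 - β y) * y * E) : ℝ) : ℂ) := by push_cast; ring
    rw [e5, Complex.ofReal_re]; ring
  have hly : Tendsto (fun y : ℝ => Real.log y / y) atTop (nhds 0) := by
    simpa using (Real.isLittleO_log_id_atTop).tendsto_div_nhds_zero
  have key : ∀ y : ℝ, (1 - β y) * y = ((1 - β y) * y * Real.exp (-(2 * ((1 - β y) * Real.log y))))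
      * Real.exp (2 * ((1 - β y) * Real.log y)) := by
    intro y
    rw [mul_assoc _ (Real.exp _), ← Real.exp_add]; simp
  have hd : Tendsto (fun y => (1 - β y) * Real.log y) atTop (nhds 0) := by
    have hup : Tendsto (fun y => ((1 - β y) * y * Real.exp (-(2 * ((1 - β y) * Real.log y))))
        * Real.exp (2 * ε) * (Real.log y / y)) atTop (nhds 0) := by
      simpa using (hu.mul_const (Real.exp (2 * ε))).mul hly
    refine tendsto_of_tendsto_of_tendsto_of_le_of_le' tendsto_const_nhds hup ?_ ?_
    · filter_upwards [hYev, eventually_gt_atTop 1] with y hy h1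
      exact mul_nonneg (by linarith [(hβ y hy).2.1]) (Real.log_pos h1).le
    · filter_upwards [hYev, eventually_gt_atTop 1] with y hy h1
      have hl := Real.log_pos h1
      obtain ⟨ha, hb1, -⟩ := hβ y hy
      have hy0 : 0 < y := by linarith
      have hle : (1 - β y) * Real.log y ≤ ε := by
        have : 1 - β y ≤ ε * (Real.log y)⁻¹ := by linarith
        calc _ ≤ ε * (Real.log y)⁻¹ * Real.log y := by gcongr
          _ = ε := by field_simp
      have e : (1 - β y) * Real.log y = (1 - β y) * y * (Real.log y / y) := by field_simp
      have hd0 : 0 < 1 - β y := by linarith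
      calc (1 - β y) * Real.log y = (1 - β y) * y * (Real.log y / y) := e
        _ = ((1 - β y) * y * Real.exp (-(2 * ((1 - β y) * Real.log y))))
          * Real.exp (2 * ((1 - β y) * Real.log y)) * (Real.log y / y) := by rw [← key y]
        _ ≤ _ := by gcongr
  have hexp : Tendsto (fun y => Real.exp (2 * ((1 - β y) * Real.log y))) atTop (nhds 1) := by
    have := (Real.continuous_exp.tendsto _).comp (hd.const_mul 2)
    simpa [Function.comp_def] using this
  have hfin := (hu.mul hexp).mul_const (π / 3)
  have e : 3 / π * 1 * (π / 3) = 1 := by have := Real.pi_ne_zero; field_simp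
  rw [e] at hfin
  refine hfin.congr fun y => ?_
  rw [← key y]; ring
end
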